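/- arXiv:2602.11922 — 3 statements merged into one kernel-verified Lean document; each statement's English description precedes it below -/
import Mathlib

section
/- Let p > 0, let A and B be positive semidefinite n×n complex matrices, and let |||·||| be any unitarily invariant norm on Mₙ(ℂ) (i.e. |||UXV||| = |||X||| for all unitaries U, V). Then |||A κₚ B||| ≤ |||A|||^{1/2} · |||B|||^{1/2}. -/
open scoped ComplexOrder

/-- Real power of a square complex matrix, taken via the continuous functional calculus
(on the spectrum, which lies in `[0, ∞)` for positive semidefinite matrices). -/
noncomputable def Matrix.rpowCFC {n : Type*} [Fintype n] [DecidableEq n]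
    (A : Matrix n n ℂ) (r : ℝ) : Matrix n n ℂ :=
  cfc (fun x : ℝ => x ^ r) A

/-- The operation `A κₚ B := (A^{p/4} B^{p/2} A^{p/4})^{1/p}`. -/
noncomputable def Matrix.kappa {n : Type*} [Fintype n] [DecidableEq n]
    (p : ℝ) (A B : Matrix n n ℂ) : Matrix n n ℂ :=
  (A.rpowCFC (p / 4) * B.rpowCFC (p / 2) * A.rpowCFC (p / 4)).rpowCFC p⁻¹

/-- Abel summation bound: a weighted sum with antitone weights dominates the smallest weight times
the plain sum, provided all partial sums are nonnegative. -/
theorem mul_sum_le_sum_mul_of_antitone {m : ℕ} {w u : Fin m → ℝ} (hw : Antitone w)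
    (hu : ∀ (k : ℕ) (hk : k ≤ m), 0 ≤ ∑ i : Fin k, u (Fin.castLE hk i)) (k : ℕ) (hk : k ≤ m)
    (t : ℝ) (ht : ∀ i : Fin k, t ≤ w (Fin.castLE hk i)) :
    t * ∑ i : Fin k, u (Fin.castLE hk i) ≤
      ∑ i : Fin k, w (Fin.castLE hk i) * u (Fin.castLE hk i) := by
  induction k generalizing t with
  | zero => simp
  | succ k ih =>
    have hsum := hu (k + 1) hk
    have hlast := ht (Fin.last k)
    have key := ih (Nat.le_of_succ_le hk) (w (Fin.castLE hk (Fin.last k)))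
      (fun i => hw (by
        rw [Fin.le_def]
        exact i.isLt.le))
    refine (mul_le_mul_of_nonneg_right hlast hsum).trans ?_
    rw [Fin.sum_univ_castSucc, Fin.sum_univ_castSucc, mul_add]
    exact add_le_add_left key _

theorem pos_of_prod_castLE_le {m : ℕ} {x y : Fin m → ℝ} (hx : Antitone x) (hy0 : ∀ i, 0 ≤ y i)
    (h : ∀ (k : ℕ) (hk : k ≤ m),
      ∏ i : Fin k, x (Fin.castLE hk i) ≤ ∏ i : Fin k, y (Fin.castLE hk i))
    {i : Fin m} (hi : 0 < x i) : 0 < y i := by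
  have hprod := (Finset.prod_pos fun j _ => hi.trans_le (hx (by
    rw [Fin.le_def]
    exact Nat.le_of_lt_succ j.isLt))).trans_le (h (i + 1) i.isLt)
  exact (hy0 i).lt_of_ne'
    (Finset.prod_ne_zero_iff.mp hprod.ne' (Fin.last i) (Finset.mem_univ _))

theorem sum_log_div_nonneg {m : ℕ} {x y : Fin m → ℝ} (hx : Antitone x) (hx0 : ∀ i, 0 ≤ x i)
    (hy0 : ∀ i, 0 ≤ y i)
    (h : ∀ (k : ℕ) (hk : k ≤ m),
      ∏ i : Fin k, x (Fin.castLE hk i) ≤ ∏ i : Fin k, y (Fin.castLE hk i))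
    (k : ℕ) (hk : k ≤ m) :
    0 ≤ ∑ i : Fin k, Real.log (y (Fin.castLE hk i) / x (Fin.castLE hk i)) := by
  induction k with
  | zero => simp
  | succ k ih =>
    rcases (hx0 (Fin.castLE hk (Fin.last k))).eq_or_lt with h0 | hpos
    · rw [Fin.sum_univ_castSucc, ← h0, div_zero, Real.log_zero, add_zero]
      exact ih (Nat.le_of_succ_le hk)
    · have hxp : ∀ i : Fin (k + 1), 0 < x (Fin.castLE hk i) := fun i =>
        hpos.trans_le (hx (by
          rw [Fin.le_def]
          exact Nat.le_of_lt_succ i.isLt))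
      rw [← Real.log_prod fun i _ =>
        (div_pos (pos_of_prod_castLE_le hx hy0 h (hxp i)) (hxp i)).ne', Finset.prod_div_distrib]
      exact Real.log_nonneg ((one_le_div (Finset.prod_pos fun i _ => hxp i)).mpr (h (k + 1) hk))

/-- Weak log-majorization implies weak majorization, in weighted form. -/
theorem sum_mul_le_sum_mul_of_prod_le {m : ℕ} {c x y : Fin m → ℝ} (hc : Antitone c)
    (hc0 : ∀ i, 0 ≤ c i) (hx : Antitone x) (hx0 : ∀ i, 0 ≤ x i) (hy0 : ∀ i, 0 ≤ y i)
    (h : ∀ (k : ℕ) (hk : k ≤ m),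
      ∏ i : Fin k, x (Fin.castLE hk i) ≤ ∏ i : Fin k, y (Fin.castLE hk i)) :
    ∑ i, c i * x i ≤ ∑ i, c i * y i := by
  have hlog : 0 ≤ ∑ i, c i * x i * Real.log (y i / x i) := by
    have := mul_sum_le_sum_mul_of_antitone (w := fun i => c i * x i)
      (u := fun i => Real.log (y i / x i))
      (fun i j hij => mul_le_mul (hc hij) (hx hij) (hx0 j) (hc0 i))
      (sum_log_div_nonneg hx hx0 hy0 h) m le_rfl 0 (fun i => mul_nonneg (hc0 _) (hx0 _))
    simpa using this
  have hterm : ∀ i, c i * x i * Real.log (y i / x i) ≤ c i * y i - c i * x i := by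
    intro i
    rcases (hx0 i).eq_or_lt with h0 | hpos
    · simpa [← h0] using mul_nonneg (hc0 i) (hy0 i)
    · have := mul_le_mul_of_nonneg_left
        (Real.log_le_sub_one_of_pos (div_pos (pos_of_prod_castLE_le hx hy0 h hpos) hpos))
        (mul_nonneg (hc0 i) (hx0 i))
      refine this.trans (le_of_eq ?_)
      field_simp
  have := hlog.trans (Finset.sum_le_sum fun i _ => hterm i)
  rw [Finset.sum_sub_distrib] at this
  linarith

/-- A symmetric gauge function is monotone with respect to weak log-majorization. -/
theorem symmetricGauge_le_of_prod_le {m : ℕ} {Φ : (Fin m → ℝ) → ℝ}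
    (hadd : ∀ x y, Φ (x + y) ≤ Φ x + Φ y) (hsmul : ∀ (c : ℝ) x, Φ (c • x) = |c| * Φ x)
    (hperm : ∀ (σ : Equiv.Perm (Fin m)) x, Φ (x ∘ σ) = Φ x)
    (hsign : ∀ s x : Fin m → ℝ, (∀ i, |s i| = 1) → Φ (s * x) = Φ x)
    {x y : Fin m → ℝ} (hx : Antitone x) (hx0 : ∀ i, 0 ≤ x i) (hy0 : ∀ i, 0 ≤ y i)
    (h : ∀ (k : ℕ) (hk : k ≤ m),
      ∏ i : Fin k, x (Fin.castLE hk i) ≤ ∏ i : Fin k, y (Fin.castLE hk i)) :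
    Φ x ≤ Φ y := by
  have hzero : Φ 0 = 0 := by simpa using hsmul 0 0
  have hnonneg : ∀ z, 0 ≤ Φ z := fun z => by
    have h1 := hadd z (-z)
    have h2 := hsmul (-1) z
    simp only [neg_smul, one_smul, abs_neg, abs_one, one_mul] at h2
    rw [add_neg_cancel, hzero, h2] at h1
    linarith
  obtain ⟨g, hgx, hg⟩ : ∃ g : (Fin m → ℝ) →ₗ[ℝ] ℝ, g x = Φ x ∧ ∀ z, g z ≤ Φ z := by
    rcases eq_or_ne x 0 with rfl | hx'
    · exact ⟨0, by simp [hzero], fun z => by simpa using hnonneg z⟩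
    · obtain ⟨g, hg1, hg2⟩ := exists_extension_of_le_sublinear
        (LinearPMap.mkSpanSingleton x (Φ x) hx') Φ
        (fun c hc z => by rw [hsmul, abs_of_pos hc]) hadd (by
          rintro ⟨z, hz⟩
          obtain ⟨c, rfl⟩ := Submodule.mem_span_singleton.mp hz
          have : LinearPMap.mkSpanSingleton x (Φ x) hx' ⟨c • x, hz⟩ = c * Φ x :=
            LinearPMap.mkSpanSingleton'_apply x (Φ x) _ c hz
          rw [this, hsmul]
          exact mul_le_mul_of_nonneg_right (le_abs_self c) (hnonneg x))
      refine ⟨g, ?_, hg2⟩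
      have := hg1 ⟨x, Submodule.mem_span_singleton_self x⟩
      rwa [LinearPMap.mkSpanSingleton_apply] at this
  set c : Fin m → ℝ := fun i => g (Pi.single i 1) with hc
  have hgc : ∀ z, g z = ∑ i, c i * z i := fun z => by
    rw [LinearMap.pi_apply_eq_sum_univ g z]
    refine Finset.sum_congr rfl fun i _ => ?_
    rw [smul_eq_mul, mul_comm]
    congr 2
    ext j
    simp [Pi.single_apply, eq_comm]
  set σ := Tuple.sort fun i => -|c i|
  have hσ : Antitone fun i => |c (σ i)| := fun i j hij => by
    simpa using Tuple.monotone_sort (fun i => -|c i|) hij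
  set s : Fin m → ℝ := fun i => if 0 ≤ c i then 1 else -1
  have hs : ∀ i, |s i| = 1 := fun i => by
    by_cases hi : 0 ≤ c i <;> simp [s, hi]
  have hcs : ∀ i, c i * s i = |c i| := fun i => by
    by_cases hi : 0 ≤ c i
    · simp [s, hi, abs_of_nonneg hi]
    · simp [s, hi, abs_of_neg (not_le.mp hi)]
  calc Φ x = ∑ i, c i * x i := by rw [← hgx, hgc]
    _ ≤ ∑ i, |c (σ (σ.symm i))| * x i := by
      refine Finset.sum_le_sum fun i _ => ?_
      rw [Equiv.apply_symm_apply]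
      exact mul_le_mul_of_nonneg_right (le_abs_self _) (hx0 i)
    _ ≤ ∑ i, |c (σ i)| * x i :=
      (hσ.monovary hx).sum_comp_perm_mul_le_sum_mul (σ := σ.symm)
    _ ≤ ∑ i, |c (σ i)| * y i :=
      sum_mul_le_sum_mul_of_prod_le hσ (fun _ => abs_nonneg _) hx hx0 hy0 h
    _ = ∑ i, c i * (s * (y ∘ σ.symm)) i := by
      rw [← Equiv.sum_comp σ fun i => c i * (s * (y ∘ σ.symm)) i]
      refine Finset.sum_congr rfl fun i _ => ?_
      simp [← hcs, mul_assoc]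
    _ ≤ Φ y := by
      rw [← hgc]
      refine (hg _).trans (le_of_eq ?_)
      rw [hsign _ _ hs, hperm]

theorem prod_comp_le_prod_castLE {m k : ℕ} {d : Fin m → ℝ} (hd : Antitone d) (hd0 : ∀ i, 0 ≤ d i)
    (hk : k ≤ m) {f : Fin k → Fin m} (hf : Function.Injective f) :
    ∏ i, d (f i) ≤ ∏ i, d (Fin.castLE hk i) := by
  rw [← Equiv.prod_comp (Tuple.sort f)]
  have hmono : StrictMono (f ∘ Tuple.sort f) :=
    (Tuple.monotone_sort f).strictMono_of_injective (hf.comp (Tuple.sort f).injective)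
  refine Finset.prod_le_prod (fun _ _ => hd0 _) fun i _ => hd ?_
  obtain ⟨i, hi⟩ := i
  rw [Fin.le_def]
  change i ≤ ((f ∘ Tuple.sort f) ⟨i, hi⟩ : ℕ)
  induction i with
  | zero => exact Nat.zero_le _
  | succ i ih =>
    have h1 := ih (Nat.lt_of_succ_lt hi) (Finset.mem_univ _)
    have h2 : (f ∘ Tuple.sort f) ⟨i, Nat.lt_of_succ_lt hi⟩ < (f ∘ Tuple.sort f) ⟨i + 1, hi⟩ :=
      hmono (Fin.mk_lt_mk.mpr i.lt_succ_self)
    exact Nat.succ_le_of_lt (h1.trans_lt h2)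

theorem le_sqrt_mul_sqrt_of_forall_le {x α β : ℝ} (hα : 0 ≤ α) (hβ : 0 ≤ β)
    (h : ∀ t : ℝ, 0 < t → x ≤ (t * α + t⁻¹ * β) / 2) : x ≤ √α * √β := by
  rcases hα.eq_or_lt with rfl | hα'
  · by_contra! hx
    rw [Real.sqrt_zero, zero_mul] at hx
    have := h ((β + 1) / x) (by positivity)
    rw [mul_zero, zero_add, inv_div, div_mul_eq_mul_div, div_div, le_div_iff₀ (by positivity)]
      at this
    nlinarith
  · rcases hβ.eq_or_lt with rfl | hβ'
    · by_contra! hx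
      rw [Real.sqrt_zero, mul_zero] at hx
      have := h (x / (α + 1)) (by positivity)
      rw [mul_zero, add_zero, div_mul_eq_mul_div, div_div, le_div_iff₀ (by positivity)] at this
      nlinarith
    · have ha := Real.sqrt_pos.mpr hα'
      have hb := Real.sqrt_pos.mpr hβ'
      have h1 := h (√β / √α) (by positivity)
      have h2 : √β / √α * α = √α * √β := by
        rw [div_mul_eq_mul_div, div_eq_iff ha.ne']
        linear_combination √β * (-Real.mul_self_sqrt hα)
      have h3 : (√β / √α)⁻¹ * β = √α * √β := by
        rw [inv_div, div_mul_eq_mul_div, div_eq_iff hb.ne']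
        linear_combination √α * (-Real.mul_self_sqrt hβ)
      rw [h2, h3] at h1
      linarith

namespace Matrix

theorem det_mul_eq_sum_prod_mul_det_submatrix {n κ R : Type*} [Fintype n] [Fintype κ]
    [DecidableEq κ] [CommRing R] (X : Matrix κ n R) (Y : Matrix n κ R) :
    (X * Y).det = ∑ f : κ → n, (∏ i, X i (f i)) * (Y.submatrix f id).det := by
  classical
  have h : (X * Y : Matrix κ κ R) = fun i => ∑ j, X i j • Y j := by
    ext i l
    simp [Matrix.mul_apply]
  rw [h]
  change detRowAlternating.toMultilinearMap (fun i => ∑ j, X i j • Y j) = _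
  rw [MultilinearMap.map_sum]
  refine Finset.sum_congr rfl fun f _ => ?_
  rw [MultilinearMap.map_smul_univ]
  rfl

/-- The **Cauchy–Binet formula**, with the sum taken over all maps. -/
theorem factorial_mul_det_mul {n κ R : Type*} [Fintype n] [Fintype κ]
    [DecidableEq κ] [CommRing R] (X : Matrix κ n R) (Y : Matrix n κ R) :
    ((Fintype.card κ).factorial : R) * (X * Y).det =
      ∑ f : κ → n, (X.submatrix id f).det * (Y.submatrix f id).det := by
  classical
  have h : ∀ σ : Equiv.Perm κ, (X * Y).det =
      ∑ f : κ → n, (∏ i, X i (f (σ i))) * ((Equiv.Perm.sign σ : ℤ) : R) *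
        (Y.submatrix f id).det := by
    intro σ
    rw [det_mul_eq_sum_prod_mul_det_submatrix,
      ← Equiv.sum_comp (Equiv.arrowCongr σ.symm (Equiv.refl n))]
    refine Finset.sum_congr rfl fun f _ => ?_
    have := det_permute σ (Y.submatrix f id)
    rw [mul_assoc, ← this]
    rfl
  have hsum : ((Fintype.card κ).factorial : R) * (X * Y).det =
      ∑ _σ : Equiv.Perm κ, (X * Y).det := by
    rw [Finset.sum_const, Finset.card_univ, Fintype.card_perm, nsmul_eq_mul]
  rw [hsum, Fintype.sum_congr _ _ h, Finset.sum_comm]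
  refine Finset.sum_congr rfl fun f _ => ?_
  rw [← Finset.sum_mul, ← det_transpose (X.submatrix id f), det_apply' (X.submatrix id f)ᵀ]
  refine congrArg (· * _) (Finset.sum_congr rfl fun σ _ => ?_)
  rw [mul_comm]
  rfl

theorem factorial_mul_re_det_conjTranspose_mul_diagonal_mul {n κ : Type*} [Fintype n]
    [DecidableEq n] [Fintype κ] [DecidableEq κ] (Y : Matrix n κ ℂ) (d : n → ℝ) :
    ((Fintype.card κ).factorial : ℝ) * (Yᴴ * diagonal (fun i => (d i : ℂ)) * Y).det.re =
      ∑ f : κ → n, (∏ i, d (f i)) * Complex.normSq (Y.submatrix f id).det := by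
  have h := factorial_mul_det_mul (Yᴴ * diagonal (fun i => (d i : ℂ))) Y
  have hf : ∀ f : κ → n, ((Yᴴ * diagonal (fun i => (d i : ℂ))).submatrix id f).det *
      (Y.submatrix f id).det =
      (((∏ i, d (f i)) * Complex.normSq (Y.submatrix f id).det : ℝ) : ℂ) := by
    intro f
    have h1 : (Yᴴ * diagonal (fun i => (d i : ℂ))).submatrix id f =
        (Y.submatrix f id)ᴴ * diagonal fun i => (d (f i) : ℂ) := by
      ext i j
      simp
    rw [h1, det_mul, det_diagonal, det_conjTranspose]
    push_cast
    rw [Complex.normSq_eq_conj_mul_self]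
    simp only [RCLike.star_def]
    ring
  rw [Finset.sum_congr rfl fun f _ => hf f, ← Complex.ofReal_sum] at h
  have := congrArg Complex.re h
  rw [Complex.ofReal_re] at this
  rw [← this, ← Complex.ofReal_natCast, Complex.re_ofReal_mul]

theorem re_det_conjTranspose_mul_diagonal_mul_le {n κ : Type*} [Fintype n] [DecidableEq n]
    [Fintype κ] [DecidableEq κ] (Y : Matrix n κ ℂ) (d : n → ℝ) (c : ℝ)
    (hc : ∀ f : κ → n, Function.Injective f → ∏ i, d (f i) ≤ c) :
    (Yᴴ * diagonal (fun i => (d i : ℂ)) * Y).det.re ≤ c * (Yᴴ * Y).det.re := by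
  have hpos : (0 : ℝ) < (Fintype.card κ).factorial := by
    exact_mod_cast Nat.factorial_pos _
  have h1 := factorial_mul_re_det_conjTranspose_mul_diagonal_mul Y fun _ => 1
  simp only [Complex.ofReal_one, diagonal_one, Matrix.mul_one, Finset.prod_const_one, one_mul] at h1
  refine le_of_mul_le_mul_left ?_ hpos
  rw [factorial_mul_re_det_conjTranspose_mul_diagonal_mul, mul_left_comm, h1, Finset.mul_sum]
  refine Finset.sum_le_sum fun f _ => ?_
  by_cases hf : Function.Injective f
  · exact mul_le_mul_of_nonneg_right (hc f hf) (Complex.normSq_nonneg _)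
  · have : (Y.submatrix f id).det = 0 := by
      obtain ⟨i, j, hij, hne⟩ : ∃ i j, f i = f j ∧ i ≠ j := by
        simpa [Function.Injective] using hf
      exact det_zero_of_row_eq hne (by ext l; simp [hij])
    simp [this]

end Matrix

namespace Matrix

open scoped Matrix

/-- Spectral decomposition of a Hermitian matrix with eigenvalues listed in decreasing order,
together with the induced formula for the continuous functional calculus. -/
theorem IsHermitian.exists_antitone_cfc_eq {n : Type*} [Fintype n] [DecidableEq n]
    {A : Matrix n n ℂ} (hA : A.IsHermitian) :
    ∃ a : Fin (Fintype.card n) → ℝ, Antitone a ∧ (A.PosSemidef → ∀ i, 0 ≤ a i) ∧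
      ∃ U ∈ unitary (Matrix n n ℂ), ∀ f : ℝ → ℝ, cfc f A =
        U * diagonal (fun i => ((f (a ((Fintype.equivOfCardEq (Fintype.card_fin _)).symm i)) : ℝ) :
          ℂ)) * star U := by
  refine ⟨hA.eigenvalues₀, hA.eigenvalues₀_antitone, fun h i => ?_,
    hA.eigenvectorUnitary, hA.eigenvectorUnitary.2, fun f => ?_⟩
  · have := h.eigenvalues_nonneg (Fintype.equivOfCardEq (Fintype.card_fin _) i)
    simpa [IsHermitian.eigenvalues] using this
  · rw [hA.cfc_eq, IsHermitian.cfc, Unitary.conjStarAlgAut_apply]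
    rfl

theorem isHermitian_cfc {n : Type*} [Fintype n] [DecidableEq n]
    (A : Matrix n n ℂ) (f : ℝ → ℝ) : (cfc f A).IsHermitian :=
  cfc_predicate f A

/-- The Horn inequality: if `S * S` and `B` have eigenvalues `a` and `b`, then the eigenvalues of
`S * B * S` are weakly log-majorized by the products of `a` and `b`. -/
theorem prod_castLE_le_of_conj_eq {n : Type*} [Fintype n] [DecidableEq n] {m : ℕ} (e : n ≃ Fin m)
    {a b x : Fin m → ℝ} (ha : Antitone a) (ha0 : ∀ i, 0 ≤ a i) (hb : Antitone b)
    (hb0 : ∀ i, 0 ≤ b i) {U V Z : Matrix n n ℂ} (hU : U ∈ unitary (Matrix n n ℂ))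
    (hV : V ∈ unitary (Matrix n n ℂ)) (hZ : Z ∈ unitary (Matrix n n ℂ))
    {S : Matrix n n ℂ} (hS : S.IsHermitian)
    (hSS : S * S = U * diagonal (fun i => (a (e i) : ℂ)) * star U)
    (h : S * (V * diagonal (fun i => (b (e i) : ℂ)) * star V) * S =
      Z * diagonal (fun i => (x (e i) : ℂ)) * star Z) (k : ℕ) (hk : k ≤ m) :
    ∏ i : Fin k, x (Fin.castLE hk i) ≤
      (∏ i : Fin k, a (Fin.castLE hk i)) * ∏ i : Fin k, b (Fin.castLE hk i) := by
  have hinj : Function.Injective (e.symm ∘ Fin.castLE hk) :=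
    e.symm.injective.comp (Fin.castLE_injective hk)
  have hbound : ∀ {d : Fin m → ℝ}, Antitone d → (∀ i, 0 ≤ d i) → ∀ f : Fin k → n,
      Function.Injective f → ∏ i, d (e (f i)) ≤ ∏ i, d (Fin.castLE hk i) :=
    fun hd hd0 f hf => prod_comp_le_prod_castLE hd hd0 hk (e.injective.comp hf)
  set W : Matrix n (Fin k) ℂ := Z.submatrix id (e.symm ∘ Fin.castLE hk) with hW
  have hWW : Wᴴ * W = 1 := by
    have : Wᴴ * W = (star Z * Z).submatrix (e.symm ∘ Fin.castLE hk) (e.symm ∘ Fin.castLE hk) := by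
      ext i j
      simp [hW, Matrix.mul_apply, star_eq_conjTranspose]
    rw [this, Unitary.star_mul_self_of_mem hZ, submatrix_one _ hinj]
  have hleft : Wᴴ * (Z * diagonal (fun i => (x (e i) : ℂ)) * star Z) * W =
      diagonal fun i => (x (Fin.castLE hk i) : ℂ) := by
    have : Wᴴ * (Z * diagonal (fun i => (x (e i) : ℂ)) * star Z) * W =
        (star Z * (Z * diagonal (fun i => (x (e i) : ℂ)) * star Z) * Z).submatrix
          (e.symm ∘ Fin.castLE hk) (e.symm ∘ Fin.castLE hk) := by
      ext i j
      simp [hW, Matrix.mul_apply, star_eq_conjTranspose]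
    have h2 : star Z * (Z * diagonal (fun i => (x (e i) : ℂ)) * star Z) * Z =
        (star Z * Z) * diagonal (fun i => (x (e i) : ℂ)) * (star Z * Z) := by
      simp only [Matrix.mul_assoc]
    rw [this, h2, Unitary.star_mul_self_of_mem hZ, Matrix.one_mul, Matrix.mul_one,
      submatrix_diagonal _ _ hinj]
    simp [Function.comp_def]
  have step1 := re_det_conjTranspose_mul_diagonal_mul_le (star V * S * W) (fun i => b (e i)) _
    (hbound hb hb0)
  have step2 := re_det_conjTranspose_mul_diagonal_mul_le (star U * W) (fun i => a (e i)) _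
    (hbound ha ha0)
  have e1 : (star V * S * W)ᴴ * diagonal (fun i => (b (e i) : ℂ)) * (star V * S * W) =
      diagonal fun i => (x (Fin.castLE hk i) : ℂ) := by
    rw [← hleft, ← h, conjTranspose_mul, conjTranspose_mul, hS.eq, ← star_eq_conjTranspose (star V),
      star_star]
    simp only [Matrix.mul_assoc]
  have e2 : (star V * S * W)ᴴ * (star V * S * W) =
      (star U * W)ᴴ * diagonal (fun i => (a (e i) : ℂ)) * (star U * W) := by
    have : (star V * S * W)ᴴ * (star V * S * W) = Wᴴ * (S * (V * star V) * S) * W := by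
      rw [conjTranspose_mul, conjTranspose_mul, hS.eq, ← star_eq_conjTranspose (star V), star_star]
      simp only [Matrix.mul_assoc]
    rw [this, Unitary.mul_star_self_of_mem hV, Matrix.mul_one, hSS, conjTranspose_mul,
      ← star_eq_conjTranspose (star U), star_star]
    simp only [Matrix.mul_assoc]
  have e3 : (star U * W)ᴴ * (star U * W) = 1 := by
    have : (star U * W)ᴴ * (star U * W) = Wᴴ * (U * star U) * W := by
      rw [conjTranspose_mul, ← star_eq_conjTranspose (star U), star_star]
      simp only [Matrix.mul_assoc]
    rw [this, Unitary.mul_star_self_of_mem hU, Matrix.mul_one, hWW]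
  rw [e1, e2, det_diagonal, ← Complex.ofReal_prod, Complex.ofReal_re] at step1
  rw [e3, det_one, Complex.one_re, mul_one] at step2
  rw [mul_comm]
  exact step1.trans
    (mul_le_mul_of_nonneg_left step2 (Finset.prod_nonneg fun i _ => hb0 _))

/-- A unitarily invariant seminorm restricted to diagonal matrices is permutation invariant. -/
theorem apply_diagonal_comp_perm {n : Type*} [Fintype n] [DecidableEq n]
    {N : Matrix n n ℂ → ℝ} (hN : ∀ U V X : Matrix n n ℂ, U ∈ unitary (Matrix n n ℂ) →
      V ∈ unitary (Matrix n n ℂ) → N (U * X * V) = N X) (σ : Equiv.Perm n) (d : n → ℂ) :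
    N (diagonal (d ∘ σ)) = N (diagonal d) := by
  have h1 : (1 : Matrix n n ℂ).submatrix σ id * (1 : Matrix n n ℂ).submatrix id σ = 1 := by
    rw [submatrix_mul _ _ _ _ _ Function.bijective_id |>.symm]
    simp
  have h2 : (1 : Matrix n n ℂ).submatrix id σ * (1 : Matrix n n ℂ).submatrix σ id = 1 := by
    rw [submatrix_mul _ _ _ _ _ σ.bijective |>.symm]
    simp
  have hs : star ((1 : Matrix n n ℂ).submatrix σ id) = (1 : Matrix n n ℂ).submatrix id σ := by
    rw [star_eq_conjTranspose, conjTranspose_submatrix, conjTranspose_one]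
  have hs' : star ((1 : Matrix n n ℂ).submatrix id σ) = (1 : Matrix n n ℂ).submatrix σ id := by
    rw [← hs, star_star]
  rw [← hN _ _ (diagonal d) (Unitary.mem_iff.mpr ⟨by rw [hs, h2], by rw [hs, h1]⟩)
    (Unitary.mem_iff.mpr ⟨by rw [hs', h1], by rw [hs', h2]⟩)]
  congr 1
  ext i j
  rcases eq_or_ne i j with rfl | hij
  · simp [Matrix.mul_apply, diagonal_apply, one_apply]
  · simp [Matrix.mul_apply, diagonal_apply, one_apply, hij]

end Matrix

/-- Trace arithmetic–κₚ inequality, unitarily invariant norm form (first half):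
for any unitarily invariant norm `N` on `Mₙ(ℂ)` and positive semidefinite `A, B`,
`|||A κₚ B||| ≤ |||A|||^{1/2} · |||B|||^{1/2}`. -/
theorem kappa_uinorm_le {n : Type*} [Fintype n] [DecidableEq n]
    (p : ℝ) (hp : 0 < p) (A B : Matrix n n ℂ) (hA : A.PosSemidef) (hB : B.PosSemidef)
    (N : Matrix n n ℂ → ℝ)
    (N_add : ∀ X Y : Matrix n n ℂ, N (X + Y) ≤ N X + N Y)
    (N_smul : ∀ (c : ℂ) (X : Matrix n n ℂ), N (c • X) = ‖c‖ * N X)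
    (N_definite : ∀ X : Matrix n n ℂ, N X = 0 → X = 0)
    (N_unitary : ∀ U V X : Matrix n n ℂ, U ∈ unitary (Matrix n n ℂ) →
      V ∈ unitary (Matrix n n ℂ) → N (U * X * V) = N X) :
    N (Matrix.kappa p A B) ≤ N A ^ ((1 : ℝ) / 2) * N B ^ ((1 : ℝ) / 2) := by
  set e : n ≃ Fin (Fintype.card n) := (Fintype.equivOfCardEq (Fintype.card_fin _)).symm with he
  set Φ : (Fin (Fintype.card n) → ℝ) → ℝ := fun x => N (Matrix.diagonal fun i => (x (e i) : ℂ))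
    with hΦ
  have hadd : ∀ x y, Φ (x + y) ≤ Φ x + Φ y := fun x y => by
    simpa [hΦ, Matrix.diagonal_add] using
      N_add (Matrix.diagonal fun i => (x (e i) : ℂ)) (Matrix.diagonal fun i => (y (e i) : ℂ))
  have hsmul : ∀ (c : ℝ) x, Φ (c • x) = |c| * Φ x := fun c x => by
    have := N_smul c (Matrix.diagonal fun i => (x (e i) : ℂ))
    rw [← Matrix.diagonal_smul, Complex.norm_real, Real.norm_eq_abs] at this
    refine Eq.trans (congrArg (fun d => N (Matrix.diagonal d)) (funext fun i => ?_)) this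
    simp
  have hperm : ∀ (σ : Equiv.Perm (Fin (Fintype.card n))) x, Φ (x ∘ σ) = Φ x := fun σ x => by
    have := Matrix.apply_diagonal_comp_perm N_unitary (e.trans (σ.trans e.symm))
      fun i => (x (e i) : ℂ)
    simpa [hΦ, Function.comp_def] using this
  have hsign : ∀ s x : Fin (Fintype.card n) → ℝ, (∀ i, |s i| = 1) → Φ (s * x) = Φ x :=
    fun s x hs => by
    have hss : ∀ i, (s i : ℂ) * s i = 1 := fun i => by
      rw [← Complex.ofReal_mul, ← abs_mul_abs_self, hs, one_mul, Complex.ofReal_one]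
    have hu : Matrix.diagonal (fun i => (s (e i) : ℂ)) ∈ unitary (Matrix n n ℂ) := by
      rw [Unitary.mem_iff, Matrix.star_eq_conjTranspose, Matrix.diagonal_conjTranspose]
      simp [Pi.star_def, hss]
    have := N_unitary _ 1 (Matrix.diagonal fun i => (x (e i) : ℂ)) hu (one_mem _)
    rw [mul_one, Matrix.diagonal_mul_diagonal] at this
    simpa [hΦ] using this
  have hconj : ∀ (U : Matrix n n ℂ) (x : Fin (Fintype.card n) → ℝ), U ∈ unitary (Matrix n n ℂ) →
      N (U * Matrix.diagonal (fun i => (x (e i) : ℂ)) * star U) = Φ x :=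
    fun U x hU => N_unitary _ _ _ hU (Unitary.star_mem hU)
  have hΦ0 : ∀ x, 0 ≤ Φ x := fun x => by
    have h1 := hadd x (-x)
    have h2 := hsmul (-1) x
    have h3 := hsmul 0 0
    simp only [neg_smul, one_smul, abs_neg, abs_one, one_mul, zero_smul, abs_zero, zero_mul]
      at h2 h3
    rw [add_neg_cancel, h3, h2] at h1
    linarith
  obtain ⟨a, ha, ha0, U, hU, hAcfc⟩ := hA.1.exists_antitone_cfc_eq
  obtain ⟨b, hb, hb0, V, hV, hBcfc⟩ := hB.1.exists_antitone_cfc_eq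
  rw [← he] at hAcfc hBcfc
  replace ha0 := ha0 hA
  replace hb0 := hb0 hB
  have hNA : N A = Φ a := by
    rw [← hconj U a hU, ← cfc_id ℝ A hA.1.isSelfAdjoint, hAcfc]
    rfl
  have hNB : N B = Φ b := by
    rw [← hconj V b hV, ← cfc_id ℝ B hB.1.isSelfAdjoint, hBcfc]
    rfl
  set S := A.rpowCFC (p / 4) with hSdef
  have hS : S.IsHermitian := Matrix.isHermitian_cfc A _
  have hSS : S * S = U * Matrix.diagonal (fun i => ((a (e i) ^ (p / 2) : ℝ) : ℂ)) * star U := by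
    have h1 : S * S = U * (Matrix.diagonal (fun i => ((a (e i) ^ (p / 4) : ℝ) : ℂ)) *
        (star U * U) * Matrix.diagonal (fun i => ((a (e i) ^ (p / 4) : ℝ) : ℂ))) * star U := by
      rw [hSdef, Matrix.rpowCFC, hAcfc]
      simp only [Matrix.mul_assoc]
    rw [h1, Unitary.star_mul_self_of_mem hU, Matrix.mul_one, Matrix.diagonal_mul_diagonal]
    congr 3
    ext i
    rw [← Complex.ofReal_mul, ← Real.rpow_add_of_nonneg (ha0 _) (by positivity) (by positivity)]
    congr 2
    ring
  set M := S * B.rpowCFC (p / 2) * S with hM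
  have hMpos : M.PosSemidef := by
    have hBp : (B.rpowCFC (p / 2)).PosSemidef := by
      rw [Matrix.rpowCFC, hBcfc]
      refine (Matrix.PosSemidef.diagonal fun i => ?_).mul_mul_conjTranspose_same V
      exact Complex.zero_le_real.mpr (Real.rpow_nonneg (hb0 _) _)
    have := hBp.mul_mul_conjTranspose_same S
    rwa [hS.eq] at this
  obtain ⟨x, hx, hx0, Z, hZ, hMcfc⟩ := hMpos.1.exists_antitone_cfc_eq
  rw [← he] at hMcfc
  replace hx0 := hx0 hMpos
  have hNk : N (Matrix.kappa p A B) = Φ fun i => x i ^ p⁻¹ := by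
    refine Eq.trans (congrArg N ?_) (hconj Z (fun i => x i ^ p⁻¹) hZ)
    rw [Matrix.kappa, Matrix.rpowCFC, hMcfc]
  have hprod : ∀ (k : ℕ) (hk : k ≤ Fintype.card n), ∏ i : Fin k, x (Fin.castLE hk i) ≤
      (∏ i : Fin k, a (Fin.castLE hk i) ^ (p / 2)) *
        ∏ i : Fin k, b (Fin.castLE hk i) ^ (p / 2) := by
    refine Matrix.prod_castLE_le_of_conj_eq e (a := fun i => a i ^ (p / 2))
      (b := fun i => b i ^ (p / 2))
      (fun i j hij => Real.rpow_le_rpow (ha0 j) (ha hij) (by positivity))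
      (fun i => Real.rpow_nonneg (ha0 i) _)
      (fun i j hij => Real.rpow_le_rpow (hb0 j) (hb hij) (by positivity))
      (fun i => Real.rpow_nonneg (hb0 i) _) hU hV hZ hS hSS ?_
    rw [← hBcfc fun z => z ^ (p / 2)]
    have := hMcfc id
    rw [cfc_id ℝ M hMpos.1.isSelfAdjoint] at this
    exact this
  rw [hNk, hNA, hNB, ← Real.sqrt_eq_rpow, ← Real.sqrt_eq_rpow]
  refine le_sqrt_mul_sqrt_of_forall_le (hΦ0 a) (hΦ0 b) fun t ht => ?_
  have hy0 : ∀ i, 0 ≤ (t / 2) * a i + (t⁻¹ / 2) * b i := fun i =>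
    add_nonneg (mul_nonneg (by positivity) (ha0 i)) (mul_nonneg (by positivity) (hb0 i))
  have hle : Φ (fun i => x i ^ p⁻¹) ≤ Φ ((t / 2) • a + (t⁻¹ / 2) • b) := by
    refine symmetricGauge_le_of_prod_le hadd hsmul hperm hsign
      (fun i j hij => Real.rpow_le_rpow (hx0 j) (hx hij) (by positivity))
      (fun i => Real.rpow_nonneg (hx0 i) _) hy0 fun k hk => ?_
    rw [Real.finsetProd_rpow _ _ fun i _ => hx0 _]
    refine (Real.rpow_le_rpow (Finset.prod_nonneg fun i _ => hx0 _) (hprod k hk)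
      (by positivity)).trans ?_
    rw [← Finset.prod_mul_distrib, ← Real.finsetProd_rpow _ _ fun i _ =>
      mul_nonneg (Real.rpow_nonneg (ha0 _) _) (Real.rpow_nonneg (hb0 _) _)]
    refine Finset.prod_le_prod (fun i _ => Real.rpow_nonneg
      (mul_nonneg (Real.rpow_nonneg (ha0 _) _) (Real.rpow_nonneg (hb0 _) _)) _) fun i _ => ?_
    set α := a (Fin.castLE hk i) with hα
    set β := b (Fin.castLE hk i) with hβ
    have hα0 : 0 ≤ α := ha0 _
    have hβ0 : 0 ≤ β := hb0 _
    have hp2 : p / 2 * p⁻¹ = 1 / 2 := by field_simp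
    rw [← Real.mul_rpow hα0 hβ0, ← Real.rpow_mul (mul_nonneg hα0 hβ0), hp2, ← Real.sqrt_eq_rpow]
    change √(α * β) ≤ t / 2 * α + t⁻¹ / 2 * β
    refine Real.sqrt_le_iff.mpr ⟨hy0 _, ?_⟩
    have htt : t * t⁻¹ = 1 := mul_inv_cancel₀ ht.ne'
    have : (t / 2 * α + t⁻¹ / 2 * β) ^ 2 - α * β = (t / 2 * α - t⁻¹ / 2 * β) ^ 2 := by
      linear_combination α * β * htt
    nlinarith [sq_nonneg (t / 2 * α - t⁻¹ / 2 * β)]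
  refine hle.trans ((hadd _ _).trans (le_of_eq ?_))
  rw [hsmul, hsmul, abs_of_pos (by positivity), abs_of_pos (by positivity)]
  ring
end

section
/- Let p > 0, let A and B be positive semidefinite n×n complex matrices, and let |||·||| be any unitarily invariant norm on Mₙ(ℂ). Then |||A κₚ B||| ≤ |||A|||^{1/2} · |||B|||^{1/2} ≤ (|||A||| + |||B|||)/2. -/
open scoped ComplexOrder

section

open scoped Matrix

open Finset Equiv in
/-- The Cauchy–Binet formula, summed over all maps `κ → n` instead of all subsets. -/
theorem Matrix.factorial_mul_det_mul_s1 {κ n R : Type*} [Fintype κ] [DecidableEq κ] [Fintype n]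
    [CommRing R] (M : Matrix κ n R) (N : Matrix n κ R) :
    ((Fintype.card κ).factorial : R) * (M * N).det =
      ∑ f : κ → n, (M.submatrix id f).det * (N.submatrix f id).det := by
  classical
  have expand : (M * N).det = ∑ f : κ → n, (∏ i, M i (f i)) * (N.submatrix f id).det := by
    have rows : (M * N) = fun i => ∑ j, M i j • N j := by
      ext i j
      simp [Matrix.mul_apply, Finset.sum_apply]
    calc (M * N).det = Matrix.detRowAlternating (fun i => ∑ j, M i j • N j) := by rw [rows]; rfl
      _ = ∑ f : κ → n, Matrix.detRowAlternating (fun i => M i (f i) • N (f i)) :=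
        Matrix.detRowAlternating.toMultilinearMap.map_sum (fun i j => M i j • N j)
      _ = _ := by
        refine Finset.sum_congr rfl fun f _ => ?_
        exact Matrix.detRowAlternating.toMultilinearMap.map_smul_univ
          (fun i => M i (f i)) (fun i => N (f i))
  have shuffle : ∀ σ : Perm κ,
      ∑ f : κ → n, ((Perm.sign σ : ℤ) : R) * (∏ i, M (σ i) (f i)) * (N.submatrix f id).det =
        (M * N).det := by
    intro σ
    rw [expand]
    refine (Fintype.sum_equiv (σ.arrowCongr (Equiv.refl n)) _ _ fun f => ?_)
    have hdet : (N.submatrix (f ∘ σ.symm) id).det =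
        ((Perm.sign σ : ℤ) : R) * (N.submatrix f id).det := by
      have := Matrix.det_permute σ.symm (N.submatrix f id)
      simpa [Matrix.submatrix_submatrix, Perm.sign_symm] using this
    have hprod : ∏ i, M (σ i) (f i) = ∏ i, M i (f (σ.symm i)) :=
      Fintype.prod_equiv σ _ _ fun i => by rw [Equiv.symm_apply_apply]
    have hf : σ.arrowCongr (Equiv.refl n) f = f ∘ σ.symm := rfl
    rw [hf, hdet, hprod]
    simp only [Function.comp_apply]
    ring
  calc ((Fintype.card κ).factorial : R) * (M * N).det = ∑ σ : Perm κ, (M * N).det := by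
        simp [Fintype.card_perm]
    _ = ∑ σ : Perm κ, ∑ f : κ → n,
        ((Perm.sign σ : ℤ) : R) * (∏ i, M (σ i) (f i)) * (N.submatrix f id).det :=
        Finset.sum_congr rfl fun σ _ => (shuffle σ).symm
    _ = _ := by
        rw [Finset.sum_comm]
        refine Finset.sum_congr rfl fun f _ => ?_
        rw [← Finset.sum_mul, Matrix.det_apply' (M.submatrix id f)]
        rfl

theorem Matrix.factorial_mul_det_conjTranspose_mul_diagonal_mul {κ n : Type*} [Fintype κ]
    [DecidableEq κ] [Fintype n] [DecidableEq n] (W : Matrix n κ ℂ) (d : n → ℝ) :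
    ((Fintype.card κ).factorial : ℝ) * (Wᴴ * diagonal (fun i => (d i : ℂ)) * W).det.re =
      ∑ f : κ → n, (∏ j, d (f j)) * Complex.normSq (W.submatrix f id).det := by
  have h := Matrix.factorial_mul_det_mul_s1 (Wᴴ * diagonal (fun i => (d i : ℂ))) W
  have term : ∀ f : κ → n, ((Wᴴ * diagonal (fun i => (d i : ℂ))).submatrix id f).det =
      ((∏ j, d (f j) : ℝ) : ℂ) * star (W.submatrix f id).det := by
    intro f
    have : (Wᴴ * diagonal (fun i => (d i : ℂ))).submatrix id f =
        (W.submatrix f id)ᴴ * diagonal (fun j => (d (f j) : ℂ)) := by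
      ext i j
      simp [Matrix.mul_diagonal]
    rw [this, det_mul, det_diagonal, det_conjTranspose, mul_comm]
    push_cast
    rfl
  have h' := congrArg Complex.re h
  rw [Complex.re_sum] at h'
  rw [← Complex.ofReal_natCast, Complex.re_ofReal_mul] at h'
  rw [h']
  refine Finset.sum_congr rfl fun f _ => ?_
  rw [term, mul_assoc, Complex.re_ofReal_mul]
  congr 1
  rw [Complex.star_def, mul_comm, Complex.mul_conj, Complex.ofReal_re]

/-- Compressions of a diagonalized matrix have determinant at most the largest product of
`κ` distinct eigenvalues, relative to the Gram determinant. -/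
theorem Matrix.det_compression_le {κ n : Type*} [Fintype κ] [DecidableEq κ] [Fintype n]
    [DecidableEq n] {U : Matrix n n ℂ} (hU : U ∈ unitary (Matrix n n ℂ)) (d : n → ℝ) {C : ℝ}
    (hC : ∀ f : κ → n, Function.Injective f → ∏ j, d (f j) ≤ C) (Z : Matrix n κ ℂ) :
    (Zᴴ * (U * diagonal (fun i => (d i : ℂ)) * star U) * Z).det.re ≤ C * (Zᴴ * Z).det.re := by
  set W := Uᴴ * Z with hW
  have e1 : Zᴴ * (U * diagonal (fun i => (d i : ℂ)) * star U) * Z =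
      Wᴴ * diagonal (fun i => (d i : ℂ)) * W := by
    simp [hW, Matrix.conjTranspose_mul, Matrix.mul_assoc, Matrix.star_eq_conjTranspose]
  have e2 : Zᴴ * Z = Wᴴ * diagonal (fun _ : n => ((1 : ℝ) : ℂ)) * W := by
    have : U * Uᴴ = 1 := Unitary.mul_star_self_of_mem hU
    have h1 : diagonal (fun _ : n => ((1 : ℝ) : ℂ)) = 1 := by simp
    rw [h1, Matrix.mul_one, hW, Matrix.conjTranspose_mul, Matrix.conjTranspose_conjTranspose,
      Matrix.mul_assoc, ← Matrix.mul_assoc U, this, Matrix.one_mul]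
  have hpos : (0 : ℝ) < (Fintype.card κ).factorial := by positivity
  refine le_of_mul_le_mul_left ?_ hpos
  rw [mul_left_comm, e1, e2, factorial_mul_det_conjTranspose_mul_diagonal_mul,
    factorial_mul_det_conjTranspose_mul_diagonal_mul, Finset.mul_sum]
  refine Finset.sum_le_sum fun f _ => ?_
  by_cases hf : Function.Injective f
  · simp only [Finset.prod_const_one, one_mul]
    exact mul_le_mul_of_nonneg_right (hC f hf) (Complex.normSq_nonneg _)
  · have : (W.submatrix f id).det = 0 := by
      obtain ⟨i, j, hij, hne⟩ := Function.not_injective_iff.mp hf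
      exact Matrix.det_zero_of_row_eq hne (by ext l; simp [hij])
    simp [this]

theorem Antitone.prod_le_prod_range {a : ℕ → ℝ} (ha : Antitone a) (h0 : ∀ i, 0 ≤ a i)
    (s : Finset ℕ) : ∏ i ∈ s, a i ≤ ∏ i ∈ Finset.range s.card, a i := by
  induction s using Finset.induction_on_max with
  | empty => simp
  | insert x s hx ih =>
    have hxs : x ∉ s := fun h => lt_irrefl _ (hx x h)
    have hcard : s.card ≤ x := by
      simpa using Finset.card_le_card
        (fun y hy => Finset.mem_range.mpr (hx y hy) : s ⊆ Finset.range x)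
    rw [Finset.prod_insert hxs, Finset.card_insert_of_notMem hxs, Finset.prod_range_succ, mul_comm]
    exact mul_le_mul ih (ha hcard) (h0 x) (Finset.prod_nonneg fun i _ => h0 i)

theorem Antitone.prod_comp_le_prod_range {a : ℕ → ℝ} (ha : Antitone a) (h0 : ∀ i, 0 ≤ a i)
    {k : ℕ} {g : Fin k → ℕ} (hg : Function.Injective g) :
    ∏ j, a (g j) ≤ ∏ i ∈ Finset.range k, a i := by
  have := ha.prod_le_prod_range h0 (Finset.univ.image g)
  rwa [Finset.prod_image hg.injOn, Finset.card_image_of_injective _ hg, Finset.card_univ,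
    Fintype.card_fin] at this

/-- Horn's inequality for `X * Y * X`, in terms of unitary diagonalizations with eigenvalues
in decreasing order. -/
theorem Matrix.prod_eigenvalues_mul_mul_le {n : Type*} [Fintype n] [DecidableEq n] {m : ℕ}
    (e : n ≃ Fin m) {U₁ U₂ V : Matrix n n ℂ} (hU₁ : U₁ ∈ unitary (Matrix n n ℂ))
    (hU₂ : U₂ ∈ unitary (Matrix n n ℂ)) (hV : V ∈ unitary (Matrix n n ℂ)) {a b c : ℕ → ℝ}
    (ha : Antitone a) (hb : Antitone b) (ha0 : ∀ i, 0 ≤ a i) (hb0 : ∀ i, 0 ≤ b i)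
    {X Y : Matrix n n ℂ}
    (hX : X = U₁ * diagonal (fun i => (a (e i) : ℂ)) * star U₁)
    (hY : Y = U₂ * diagonal (fun i => (b (e i) : ℂ)) * star U₂)
    (hXYX : X * Y * X = V * diagonal (fun i => (c (e i) : ℂ)) * star V) {k : ℕ} (hk : k ≤ m) :
    ∏ i ∈ Finset.range k, c i ≤ ∏ i ∈ Finset.range k, (a i ^ 2 * b i) := by
  set g : Fin k → n := fun j => e.symm (Fin.castLE hk j) with hg
  have hginj : Function.Injective g := e.symm.injective.comp (Fin.castLE_injective hk)
  set Z := V.submatrix id g with hZ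
  have hVV : Vᴴ * V = 1 := Unitary.star_mul_self_of_mem hV
  have compress : ∀ M : Matrix n n ℂ, Zᴴ * M * Z = (Vᴴ * M * V).submatrix g g := by
    intro M
    ext i j
    simp [hZ, Matrix.mul_apply]
  have hZZ : Zᴴ * Z = 1 := by
    have := compress 1
    rwa [Matrix.mul_one, Matrix.mul_one, hVV, Matrix.submatrix_one g hginj] at this
  have hc : (Zᴴ * (X * Y * X) * Z).det.re = ∏ i ∈ Finset.range k, c i := by
    have h1 : Vᴴ * (X * Y * X) * V = diagonal (fun i => (c (e i) : ℂ)) := by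
      rw [hXYX, Matrix.star_eq_conjTranspose, Matrix.mul_assoc, Matrix.mul_assoc _ Vᴴ V, hVV,
        Matrix.mul_one, ← Matrix.mul_assoc, hVV, Matrix.one_mul]
    rw [compress, h1, Matrix.submatrix_diagonal _ g hginj, Matrix.det_diagonal]
    simp only [Function.comp_apply, hg, Equiv.apply_symm_apply, Fin.val_castLE]
    rw [← Complex.ofReal_prod, Complex.ofReal_re, Finset.prod_range]
  have hXh : Xᴴ = X := by
    rw [hX]
    simp only [Matrix.star_eq_conjTranspose, Matrix.conjTranspose_mul, Matrix.diagonal_conjTranspose,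
      Matrix.conjTranspose_conjTranspose, Matrix.mul_assoc]
    congr 3
    ext i
    simp
  have hXX : X * X = U₁ * diagonal (fun i => ((a (e i) ^ 2 : ℝ) : ℂ)) * star U₁ := by
    have hUU : star U₁ * U₁ = 1 := Unitary.star_mul_self_of_mem hU₁
    calc X * X = U₁ * diagonal (fun i => (a (e i) : ℂ)) * (star U₁ * U₁) *
          diagonal (fun i => (a (e i) : ℂ)) * star U₁ := by
            rw [hX]; simp only [Matrix.mul_assoc]
      _ = _ := by
        rw [hUU, Matrix.mul_one, Matrix.mul_assoc U₁, Matrix.diagonal_mul_diagonal]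
        simp [pow_two]
  have injcomp : ∀ f : Fin k → n, Function.Injective f →
      Function.Injective (fun j => (e (f j) : ℕ)) := fun f hf =>
    Fin.val_injective.comp (e.injective.comp hf)
  have step1 := det_compression_le hU₂ (fun i => b (e i)) (κ := Fin k)
    (C := ∏ i ∈ Finset.range k, b i)
    (fun f hf => hb.prod_comp_le_prod_range hb0 (injcomp f hf)) (X * Z)
  have ha2 : Antitone (fun i => a i ^ 2) := fun i j hij => pow_le_pow_left₀ (ha0 j) (ha hij) 2
  have step2 := det_compression_le hU₁ (fun i => a (e i) ^ 2) (κ := Fin k)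
    (C := ∏ i ∈ Finset.range k, a i ^ 2)
    (fun f hf => ha2.prod_comp_le_prod_range (fun i => sq_nonneg _) (injcomp f hf)) Z
  rw [← hXX, hZZ, Matrix.det_one, Complex.one_re, mul_one] at step2
  rw [← hY, Matrix.conjTranspose_mul, hXh] at step1
  rw [← hc, Finset.prod_mul_distrib, mul_comm]
  have hb' : 0 ≤ ∏ i ∈ Finset.range k, b i := Finset.prod_nonneg fun i _ => hb0 i
  calc (Zᴴ * (X * Y * X) * Z).det.re = (Zᴴ * X * Y * (X * Z)).det.re := by
        simp only [Matrix.mul_assoc]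
    _ ≤ (∏ i ∈ Finset.range k, b i) * (Zᴴ * (X * X) * Z).det.re := by
        simpa only [Matrix.mul_assoc] using step1
    _ ≤ _ := mul_le_mul_of_nonneg_left step2 hb'

end

/-- Abel summation: a nonnegative decreasing weight preserves nonnegativity of partial sums. -/
theorem Antitone.sum_mul_nonneg_of_partial_sums {u L : ℕ → ℝ} (hu : Antitone u)
    (hu0 : ∀ i, 0 ≤ u i) {m : ℕ} (hL : ∀ k ≤ m, 0 ≤ ∑ i ∈ Finset.range k, L i) :
    0 ≤ ∑ i ∈ Finset.range m, u i * L i := by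
  have key : ∀ k ≤ m, u k * ∑ i ∈ Finset.range k, L i ≤ ∑ i ∈ Finset.range k, u i * L i := by
    intro k
    induction k with
    | zero => simp
    | succ k ih =>
      intro hk
      have h1 := ih (by omega)
      have h2 := mul_le_mul_of_nonneg_right (hu (Nat.le_succ k)) (hL (k + 1) hk)
      rw [Finset.sum_range_succ] at h2 ⊢
      rw [Finset.sum_range_succ]
      refine h2.trans ?_
      rw [mul_add]
      linarith
  exact (mul_nonneg (hu0 m) (hL m le_rfl)).trans (key m le_rfl)

/-- Weak log-majorization of decreasing sequences implies weak majorization, tested against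
decreasing nonnegative weights. -/
theorem Antitone.sum_mul_le_of_prod_le {v c d : ℕ → ℝ} (hv : Antitone v) (hc : Antitone c)
    (hv0 : ∀ i, 0 ≤ v i) (hc0 : ∀ i, 0 ≤ c i) (hd0 : ∀ i, 0 ≤ d i) {m : ℕ}
    (h : ∀ k ≤ m, ∏ i ∈ Finset.range k, c i ≤ ∏ i ∈ Finset.range k, d i) :
    ∑ i ∈ Finset.range m, v i * c i ≤ ∑ i ∈ Finset.range m, v i * d i := by
  set L : ℕ → ℝ := fun i => if c i = 0 then 0 else Real.log (d i) - Real.log (c i) with hLdef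
  have pos : ∀ k ≤ m, (∀ i < k, c i ≠ 0) → (∀ i < k, 0 < d i) := by
    intro k hk hck i hi
    refine (hd0 i).lt_of_ne' fun hdi => ?_
    have h1 := h k hk
    rw [Finset.prod_eq_zero (Finset.mem_range.mpr hi) hdi] at h1
    exact absurd h1 (not_le.mpr (Finset.prod_pos fun j hj =>
      (hc0 j).lt_of_ne' (hck j (Finset.mem_range.mp hj))))
  have hL : ∀ k ≤ m, 0 ≤ ∑ i ∈ Finset.range k, L i := by
    intro k
    induction k with
    | zero => simp
    | succ k ih =>
      intro hk
      by_cases hck : c k = 0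
      · rw [Finset.sum_range_succ]
        simpa [hLdef, hck] using ih (by omega)
      · have hne : ∀ i < k + 1, c i ≠ 0 := fun i hi h0 =>
          hck (le_antisymm (h0 ▸ hc (Nat.lt_succ_iff.mp hi)) (hc0 k))
        have hdp := pos (k + 1) hk hne
        have e1 : ∑ i ∈ Finset.range (k + 1), L i =
            Real.log (∏ i ∈ Finset.range (k + 1), d i) -
              Real.log (∏ i ∈ Finset.range (k + 1), c i) := by
          rw [Real.log_prod fun i hi => (hdp i (Finset.mem_range.mp hi)).ne',
            Real.log_prod fun i hi => hne i (Finset.mem_range.mp hi), ← Finset.sum_sub_distrib]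
          exact Finset.sum_congr rfl fun i hi => if_neg (hne i (Finset.mem_range.mp hi))
        rw [e1, sub_nonneg]
        exact Real.log_le_log (Finset.prod_pos fun i hi =>
          (hc0 i).lt_of_ne' (hne i (Finset.mem_range.mp hi))) (h (k + 1) hk)
  have hu : Antitone fun i => v i * c i := fun i j hij =>
    mul_le_mul (hv hij) (hc hij) (hc0 j) (hv0 i)
  have habel := hu.sum_mul_nonneg_of_partial_sums (fun i => mul_nonneg (hv0 i) (hc0 i)) hL
  rw [← sub_nonneg, ← Finset.sum_sub_distrib]
  refine habel.trans (Finset.sum_le_sum fun i hi => ?_)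
  by_cases hci : c i = 0
  · simpa [hci] using mul_nonneg (hv0 i) (hd0 i)
  · have hcp : 0 < c i := (hc0 i).lt_of_ne' hci
    have hdp : 0 < d i := by
      refine pos (i + 1) (Finset.mem_range.mp hi) (fun j hj h0 => ?_) i (Nat.lt_succ_self i)
      exact hci (le_antisymm (h0 ▸ hc (Nat.lt_succ_iff.mp hj)) (hc0 i))
    have hlog := Real.log_le_sub_one_of_pos (div_pos hdp hcp)
    rw [Real.log_div hdp.ne' hci] at hlog
    have h3 : c i * (Real.log (d i) - Real.log (c i)) ≤ d i - c i := by
      calc _ ≤ c i * (d i / c i - 1) := mul_le_mul_of_nonneg_left hlog hcp.le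
        _ = _ := by field_simp
    simp only [hLdef, if_neg hci]
    rw [mul_assoc, ← mul_sub]
    exact mul_le_mul_of_nonneg_left h3 (hv0 i)

/-- Every nonnegative function on a finite type is a decreasing sequence after relabelling. -/
theorem exists_antitone_relabelling {n : Type*} [Fintype n] {m : ℕ} (e : n ≃ Fin m) (w : n → ℝ)
    (hw : ∀ i, 0 ≤ w i) :
    ∃ (τ : n ≃ Fin m) (v : ℕ → ℝ), Antitone v ∧ (∀ i, 0 ≤ v i) ∧ ∀ i, w i = v (τ i) := by
  set f : Fin m → ℝ := fun j => -w (e.symm j) with hf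
  set σ := Tuple.sort f
  have hmono : Monotone (f ∘ σ) := Tuple.monotone_sort f
  refine ⟨e.trans σ.symm, fun j => if h : j < m then -f (σ ⟨j, h⟩) else 0, ?_, ?_, ?_⟩
  · intro i j hij
    by_cases hj : j < m
    · have hi : i < m := lt_of_le_of_lt hij hj
      simp only [hi, hj, dif_pos]
      exact neg_le_neg (hmono (show (⟨i, hi⟩ : Fin m) ≤ ⟨j, hj⟩ from hij))
    · by_cases hi : i < m
      · simp [hi, hj, hf, hw]
      · simp [hi, hj]
  · intro i
    by_cases hi : i < m
    · simp [hi, hf, hw]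
    · simp [hi]
  · intro i
    simp [hf]

/-- A symmetric gauge function respects weak log-majorization by the geometric mean of two
decreasing sequences. -/
theorem symmetricGauge_le_sqrt_mul_sqrt {n : Type*} [Fintype n] [DecidableEq n] {m : ℕ}
    (e : n ≃ Fin m) (Φ : (n → ℝ) → ℝ) (Φ_add : ∀ x y, Φ (x + y) ≤ Φ x + Φ y)
    (Φ_smul : ∀ (t : ℝ) x, Φ (t • x) = |t| * Φ x)
    (Φ_symm : ∀ (τ : n ≃ Fin m) (s : n → ℝ), (∀ i, s i = 1 ∨ s i = -1) → ∀ a : ℕ → ℝ,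
      Φ (fun i => s i * a (τ i)) = Φ (fun i => a (e i)))
    {a b c : ℕ → ℝ} (hc : Antitone c)
    (ha0 : ∀ i, 0 ≤ a i) (hb0 : ∀ i, 0 ≤ b i) (hc0 : ∀ i, 0 ≤ c i)
    (h : ∀ k ≤ m, ∏ i ∈ Finset.range k, c i ≤ ∏ i ∈ Finset.range k, (√(a i) * √(b i))) :
    Φ (fun i => c (e i)) ≤ √(Φ fun i => a (e i)) * √(Φ fun i => b (e i)) := by
  have Φ_zero : Φ 0 = 0 := by simpa using Φ_smul 0 0
  set x : n → ℝ := fun i => c (e i) with hx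
  obtain ⟨g, hgx, hgle⟩ : ∃ g : (n → ℝ) →ₗ[ℝ] ℝ, g x = Φ x ∧ ∀ y, g y ≤ Φ y := by
    have Φ_hom : ∀ t : ℝ, 0 < t → ∀ y, Φ (t • y) = t * Φ y := fun t ht y => by
      rw [Φ_smul, abs_of_pos ht]
    have Φ_nonneg : ∀ y, 0 ≤ Φ y := fun y => by
      have h1 := Φ_add y ((-1 : ℝ) • y)
      rw [Φ_smul] at h1
      simp [Φ_zero] at h1
      linarith
    by_cases hx0 : x = 0
    · exact ⟨0, by simp [hx0, Φ_zero], fun y => by simpa using Φ_nonneg y⟩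
    · obtain ⟨g, hg1, hg2⟩ := exists_extension_of_le_sublinear
        (LinearPMap.mkSpanSingleton x (Φ x) hx0) Φ Φ_hom Φ_add (by
          rintro ⟨y, hy⟩
          obtain ⟨t, rfl⟩ := Submodule.mem_span_singleton.mp hy
          rw [Φ_smul]
          exact (LinearPMap.mkSpanSingleton'_apply x (Φ x) _ t hy).trans_le
            (mul_le_mul_of_nonneg_right (le_abs_self t) (Φ_nonneg x)))
      refine ⟨g, ?_, hg2⟩
      exact (hg1 ⟨x, Submodule.mem_span_singleton_self x⟩).trans
        (LinearPMap.mkSpanSingleton_apply ℝ ℝ hx0 (Φ x))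
  set w : n → ℝ := fun i => g (Pi.single i 1) with hw
  have g_eq : ∀ y, g y = ∑ i, w i * y i := fun y => by
    conv_lhs => rw [← Finset.univ_sum_single y, map_sum]
    refine Finset.sum_congr rfl fun i _ => ?_
    rw [show (Pi.single i (y i) : n → ℝ) = y i • Pi.single i 1 by
      rw [← Pi.single_smul, smul_eq_mul, mul_one], map_smul, smul_eq_mul, mul_comm]
  obtain ⟨τ, v, hv, hv0, hwv⟩ := exists_antitone_relabelling e (fun i => |w i|)
    fun i => abs_nonneg _
  have toRange : ∀ y : ℕ → ℝ, ∑ i, |w i| * y (τ i) = ∑ j ∈ Finset.range m, v j * y j := by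
    intro y
    rw [Finset.sum_range, ← τ.sum_comp]
    exact Finset.sum_congr rfl fun i _ => by rw [hwv]
  have dual_le : ∀ y : ℕ → ℝ, ∑ j ∈ Finset.range m, v j * y j ≤ Φ (fun i => y (e i)) := by
    intro y
    set s : n → ℝ := fun i => if 0 ≤ w i then 1 else -1 with hs
    rw [← toRange, ← Φ_symm τ s (fun i => by by_cases h : 0 ≤ w i <;> simp [hs, h]) y]
    refine le_of_eq_of_le ?_ (hgle _)
    rw [g_eq]
    refine Finset.sum_congr rfl fun i _ => ?_
    rw [← mul_assoc]
    congr 1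
    by_cases h : 0 ≤ w i
    · simp [hs, h, abs_of_nonneg h]
    · simp [hs, h, abs_of_neg (not_le.mp h)]
  have rearr : Φ x ≤ ∑ j ∈ Finset.range m, v j * c j := by
    have hmono : Monovary (fun j : Fin m => v j) (fun j : Fin m => c j) := fun i j hij =>
      hv (le_of_not_ge fun hji => not_lt.mpr (hc hji) hij)
    have := hmono.sum_mul_comp_perm_le_sum_mul (σ := τ.symm.trans e)
    rw [Finset.sum_range]
    refine le_trans ?_ this
    rw [← hgx, g_eq, ← τ.sum_comp]
    refine Finset.sum_le_sum fun i _ => ?_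
    simp only [hx, Equiv.trans_apply, Equiv.symm_apply_apply, ← hwv]
    exact mul_le_mul_of_nonneg_right (le_abs_self _) (hc0 _)
  calc Φ x ≤ ∑ j ∈ Finset.range m, v j * c j := rearr
    _ ≤ ∑ j ∈ Finset.range m, v j * (√(a j) * √(b j)) :=
      hv.sum_mul_le_of_prod_le hc hv0 hc0 (fun i => by positivity) h
    _ = ∑ j ∈ Finset.range m, √(v j * a j) * √(v j * b j) := by
      refine Finset.sum_congr rfl fun j _ => ?_
      rw [Real.sqrt_mul (hv0 j), Real.sqrt_mul (hv0 j), mul_mul_mul_comm,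
        Real.mul_self_sqrt (hv0 j)]
    _ ≤ √(∑ j ∈ Finset.range m, v j * a j) * √(∑ j ∈ Finset.range m, v j * b j) :=
      Real.sum_sqrt_mul_sqrt_le _ (fun j => mul_nonneg (hv0 j) (ha0 j))
        fun j => mul_nonneg (hv0 j) (hb0 j)
    _ ≤ _ := mul_le_mul (Real.sqrt_le_sqrt (dual_le a)) (Real.sqrt_le_sqrt (dual_le b))
      (Real.sqrt_nonneg _) (Real.sqrt_nonneg _)

/-- Functional calculus of a positive semidefinite matrix through a unitary diagonalization with
eigenvalues in decreasing order along a fixed enumeration of the index type. -/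
theorem Matrix.PosSemidef.exists_antitone_diagonalization {n : Type*} [Fintype n] [DecidableEq n]
    {A : Matrix n n ℂ} (hA : A.PosSemidef) :
    ∃ U ∈ unitary (Matrix n n ℂ), ∃ a : ℕ → ℝ, Antitone a ∧ (∀ i, 0 ≤ a i) ∧
      ∀ f : ℝ → ℝ, cfc f A = U * diagonal (fun i =>
        (f (a ((Fintype.equivOfCardEq (Fintype.card_fin _)).symm i : Fin (Fintype.card n))) : ℂ)) *
          star U := by
  set ev := hA.isHermitian.eigenvalues₀ with hev
  have hanti : Antitone ev := hA.isHermitian.eigenvalues₀_antitone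
  have hnn : ∀ j, 0 ≤ ev j := fun j => by
    have := hA.eigenvalues_nonneg ((Fintype.equivOfCardEq (Fintype.card_fin _)) j)
    rwa [Matrix.IsHermitian.eigenvalues, Equiv.symm_apply_apply] at this
  refine ⟨hA.isHermitian.eigenvectorUnitary, hA.isHermitian.eigenvectorUnitary.2,
    fun j => if h : j < Fintype.card n then ev ⟨j, h⟩ else 0, ?_, ?_, ?_⟩
  · intro i j hij
    by_cases hj : j < Fintype.card n
    · have hi := lt_of_le_of_lt hij hj
      simp only [hi, hj, dif_pos]
      exact hanti hij
    · by_cases hi : i < Fintype.card n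
      · simp [hi, hj, hnn]
      · simp [hi, hj]
  · intro i
    by_cases hi : i < Fintype.card n
    · simp [hi, hnn]
    · simp [hi]
  · intro f
    rw [hA.isHermitian.cfc_eq, Matrix.IsHermitian.cfc, Unitary.conjStarAlgAut_apply]
    simp [Function.comp_def, Matrix.IsHermitian.eigenvalues, hev]

/-- Diagonal matrices that agree up to signs and relabelling have the same value under a
unitarily invariant function. -/
theorem Matrix.unitarilyInvariant_diagonal_sign_relabel {n : Type*} [Fintype n] [DecidableEq n]
    {m : ℕ} (N : Matrix n n ℂ → ℝ)
    (N_unitary : ∀ U V X : Matrix n n ℂ, U ∈ unitary (Matrix n n ℂ) →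
      V ∈ unitary (Matrix n n ℂ) → N (U * X * V) = N X)
    (e τ : n ≃ Fin m) (s : n → ℝ) (hs : ∀ i, s i = 1 ∨ s i = -1) (a : ℕ → ℝ) :
    N (diagonal fun i => ((s i * a (τ i) : ℝ) : ℂ)) = N (diagonal fun i => (a (e i) : ℂ)) := by
  set σ : Equiv.Perm n := τ.trans e.symm with hσ
  set P : Matrix n n ℂ := (1 : Matrix n n ℂ).submatrix σ id with hP
  have hPstar : star P = (1 : Matrix n n ℂ).submatrix id σ := by
    rw [Matrix.star_eq_conjTranspose, hP, Matrix.conjTranspose_submatrix, Matrix.conjTranspose_one]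
  have hP1 : P * star P = 1 := by
    rw [hPstar, hP, ← Matrix.submatrix_mul 1 1 σ id σ Function.bijective_id, Matrix.mul_one,
      Matrix.submatrix_one_equiv]
  have hPmem : P ∈ unitary (Matrix n n ℂ) := ⟨mul_eq_one_comm.mp hP1, hP1⟩
  set S : Matrix n n ℂ := diagonal fun i => (s i : ℂ) with hS
  have hSstar : star S = S := by
    rw [Matrix.star_eq_conjTranspose, hS, Matrix.diagonal_conjTranspose]
    congr 1
    ext i
    simp
  have hS1 : S * S = 1 := by
    rw [hS, Matrix.diagonal_mul_diagonal, ← Matrix.diagonal_one]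
    congr 1
    ext i
    rcases hs i with h | h <;> simp [h]
  have hSmem : S ∈ unitary (Matrix n n ℂ) := by
    constructor <;> rw [hSstar, hS1]
  have conj : P * (diagonal fun i => (a (e i) : ℂ)) * star P =
      diagonal fun i => (a (τ i) : ℂ) := by
    ext i j
    rw [hPstar, hP]
    by_cases hij : i = j
    · subst hij
      simp [Matrix.mul_apply, Matrix.one_apply, Matrix.diagonal_apply, hσ]
    · simp [Matrix.mul_apply, Matrix.one_apply, Matrix.diagonal_apply, hσ, hij]
  have h1 : (diagonal fun i => ((s i * a (τ i) : ℝ) : ℂ)) =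
      (S * P) * (diagonal fun i => (a (e i) : ℂ)) * star P := by
    rw [Matrix.mul_assoc S, Matrix.mul_assoc S, conj, hS, Matrix.diagonal_mul_diagonal]
    simp
  rw [h1]
  exact N_unitary _ _ _ (mul_mem hSmem hPmem) (Unitary.star_mem hPmem)

/-- Trace arithmetic–κₚ inequality, unitarily invariant norm form:
`|||A κₚ B||| ≤ |||A|||^{1/2} · |||B|||^{1/2} ≤ (|||A||| + |||B|||)/2`. -/
theorem kappa_uinorm_le_am {n : Type*} [Fintype n] [DecidableEq n]
    (p : ℝ) (hp : 0 < p) (A B : Matrix n n ℂ) (hA : A.PosSemidef) (hB : B.PosSemidef)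
    (N : Matrix n n ℂ → ℝ)
    (N_add : ∀ X Y : Matrix n n ℂ, N (X + Y) ≤ N X + N Y)
    (N_smul : ∀ (c : ℂ) (X : Matrix n n ℂ), N (c • X) = ‖c‖ * N X)
    (N_definite : ∀ X : Matrix n n ℂ, N X = 0 → X = 0)
    (N_unitary : ∀ U V X : Matrix n n ℂ, U ∈ unitary (Matrix n n ℂ) →
      V ∈ unitary (Matrix n n ℂ) → N (U * X * V) = N X) :
    N (Matrix.kappa p A B) ≤ N A ^ ((1 : ℝ) / 2) * N B ^ ((1 : ℝ) / 2) ∧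
      N A ^ ((1 : ℝ) / 2) * N B ^ ((1 : ℝ) / 2) ≤ (N A + N B) / 2 := by
  have N_nonneg : ∀ X, 0 ≤ N X := fun X => by
    have h0 : N 0 = 0 := by simpa using N_smul 0 0
    have h1 := N_add X ((-1 : ℂ) • X)
    rw [N_smul, neg_one_smul, add_neg_cancel, h0, norm_neg, norm_one] at h1
    linarith
  rw [← Real.sqrt_eq_rpow, ← Real.sqrt_eq_rpow]
  refine ⟨?_, ?_⟩
  swap
  · have h1 := sq_nonneg (√(N A) - √(N B))
    nlinarith [Real.sq_sqrt (N_nonneg A), Real.sq_sqrt (N_nonneg B)]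
  set e : n ≃ Fin (Fintype.card n) := (Fintype.equivOfCardEq (Fintype.card_fin _)).symm
  obtain ⟨U₁, hU₁, a, ha, ha0, cfcA⟩ := hA.exists_antitone_diagonalization
  obtain ⟨U₂, hU₂, b, hb, hb0, cfcB⟩ := hB.exists_antitone_diagonalization
  set X := A.rpowCFC (p / 4) with hX
  set Y := B.rpowCFC (p / 2) with hY
  have hXs : X.IsHermitian := cfc_predicate (fun x : ℝ => x ^ (p / 4)) A
  have hYp : Y.PosSemidef := by
    rw [hY, Matrix.rpowCFC, cfcB]
    exact (Matrix.PosSemidef.diagonal fun i => by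
      simpa using Real.rpow_nonneg (hb0 _) _).mul_mul_conjTranspose_same U₂
  have hM : (X * Y * X).PosSemidef := by
    simpa only [hXs.eq] using hYp.mul_mul_conjTranspose_same X
  obtain ⟨V, hV, c, hc, hc0, cfcM⟩ := hM.exists_antitone_diagonalization
  have N_diag : ∀ {U : Matrix n n ℂ}, U ∈ unitary (Matrix n n ℂ) → ∀ D,
      N (U * D * star U) = N D := fun hU D => N_unitary _ _ _ hU (Unitary.star_mem hU)
  have eA : A = U₁ * Matrix.diagonal (fun i => (a (e i) : ℂ)) * star U₁ := by
    have := cfcA id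
    rwa [cfc_id ℝ A hA.isHermitian.isSelfAdjoint] at this
  have eB : B = U₂ * Matrix.diagonal (fun i => (b (e i) : ℂ)) * star U₂ := by
    have := cfcB id
    rwa [cfc_id ℝ B hB.isHermitian.isSelfAdjoint] at this
  have eM : X * Y * X = V * Matrix.diagonal (fun i => (c (e i) : ℂ)) * star V := by
    have := cfcM id
    rwa [cfc_id ℝ (X * Y * X) hM.isHermitian.isSelfAdjoint] at this
  have rpow_anti : ∀ {r : ℝ} {f : ℕ → ℝ}, 0 ≤ r → Antitone f → (∀ i, 0 ≤ f i) →
      Antitone fun i => f i ^ r := fun hr hf hf0 i j hij =>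
    Real.rpow_le_rpow (hf0 j) (hf hij) hr
  have horn : ∀ k ≤ Fintype.card n, ∏ i ∈ Finset.range k, c i ^ p⁻¹ ≤
      ∏ i ∈ Finset.range k, (√(a i) * √(b i)) := by
    intro k hk
    have h1 := Matrix.prod_eigenvalues_mul_mul_le e hU₁ hU₂ hV
      (rpow_anti (r := p / 4) (by positivity) ha ha0)
      (rpow_anti (r := p / 2) (by positivity) hb hb0)
      (fun i => Real.rpow_nonneg (ha0 i) _) (fun i => Real.rpow_nonneg (hb0 i) _)
      (cfcA fun x => x ^ (p / 4)) (cfcB fun x => x ^ (p / 2)) eM hk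
    rw [Real.finsetProd_rpow _ _ fun i _ => hc0 i]
    refine (Real.rpow_le_rpow (Finset.prod_nonneg fun i _ => hc0 i) h1
      (inv_nonneg.mpr hp.le)).trans_eq ?_
    rw [← Real.finsetProd_rpow _ _ fun i _ =>
      mul_nonneg (sq_nonneg _) (Real.rpow_nonneg (hb0 i) _)]
    refine Finset.prod_congr rfl fun i _ => ?_
    rw [Real.mul_rpow (sq_nonneg _) (Real.rpow_nonneg (hb0 i) _), ← Real.rpow_natCast,
      ← Real.rpow_mul (ha0 i), ← Real.rpow_mul (ha0 i), ← Real.rpow_mul (hb0 i),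
      Real.sqrt_eq_rpow, Real.sqrt_eq_rpow]
    congr 2
    · field_simp
      norm_num
    · field_simp
  have main := symmetricGauge_le_sqrt_mul_sqrt e
    (fun x => N (Matrix.diagonal fun i => (x i : ℂ)))
    (fun x y => by
      refine le_of_eq_of_le ?_ (N_add _ _)
      rw [Matrix.diagonal_add]
      simp)
    (fun t x => by
      rw [← Real.norm_eq_abs, ← Complex.norm_real, ← N_smul, ← Matrix.diagonal_smul]
      congr 2
      ext i
      simp)
    (fun τ s hs y => Matrix.unitarilyInvariant_diagonal_sign_relabel N N_unitary e τ s hs y)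
    (rpow_anti (inv_nonneg.mpr hp.le) hc hc0) ha0 hb0 (fun i => Real.rpow_nonneg (hc0 i) _) horn
  have hκ : N (Matrix.kappa p A B) =
      N (Matrix.diagonal fun i => ((c (e i) ^ p⁻¹ : ℝ) : ℂ)) := by
    rw [Matrix.kappa, Matrix.rpowCFC, cfcM fun x => x ^ p⁻¹, N_diag hV]
  rw [hκ]
  refine main.trans_eq ?_
  conv_rhs => rw [eA, eB]
  rw [N_diag hU₁, N_diag hU₂]
end

section
/- Let 𝒜 be a unital C*-algebra and let τ : 𝒜 → ℂ be a positive linear functional that is tracial (τ(XY) = τ(YX) for all X, Y ∈ 𝒜) and faithful (τ(X*X) = 0 implies X = 0). Then for every p > 0 and all positive elements A, B of 𝒜, one has τ(A κₚ B) ≤ √(τ(A) · τ(B)) ≤ τ((A + B)/2). -/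
open scoped ComplexOrder

section TracialFunctional

variable {𝒜 : Type*} [CStarAlgebra 𝒜] [PartialOrder 𝒜] [StarOrderedRing 𝒜]

/-- A real-valued hermitian positive tracial functional on a C*-algebra. -/
structure IsRealTrace (φ : 𝒜 →ₗ[ℝ] ℝ) : Prop where
  nonneg : ∀ x, 0 ≤ x → 0 ≤ φ x
  comm : ∀ x y, φ (x * y) = φ (y * x)
  apply_star : ∀ x, φ (star x) = φ x

/-- The real part of a positive tracial functional is a real trace. -/
lemma isRealTrace_re (τ : 𝒜 →ₗ[ℂ] ℂ) (τ_pos : ∀ X : 𝒜, 0 ≤ X → 0 ≤ τ X)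
    (τ_tracial : ∀ X Y : 𝒜, τ (X * Y) = τ (Y * X)) :
    IsRealTrace (Complex.reLm ∘ₗ τ.restrictScalars ℝ) where
  nonneg x hx := (Complex.nonneg_iff.mp (τ_pos x hx)).1
  comm x y := by simp [τ_tracial x y]
  apply_star x := by
    have := map_star (PositiveLinearMap.mk₀ τ τ_pos) x
    have h2 : τ (star x) = star (τ x) := this
    simp [h2]

namespace IsRealTrace

variable {φ : 𝒜 →ₗ[ℝ] ℝ}

lemma mono (hφ : IsRealTrace φ) {x y : 𝒜} (h : x ≤ y) : φ x ≤ φ y := by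
  have := hφ.nonneg (y - x) (sub_nonneg.mpr h)
  rw [map_sub] at this
  linarith

/-- The arithmetic form of the Cauchy–Schwarz inequality. -/
lemma mul_le (hφ : IsRealTrace φ) (x y : 𝒜) : φ (x * y) ≤ (φ (x * star x) + φ (star y * y)) / 2 := by
  have h := hφ.nonneg _ (star_mul_self_nonneg (star x - y))
  have e : star (star x - y) * (star x - y) =
      x * star x - x * y - star (x * y) + star y * y := by
    simp only [star_sub, star_star, star_mul]
    noncomm_ring
  rw [e, map_add, map_sub, map_sub, hφ.apply_star] at h
  linarith

omit [StarOrderedRing 𝒜] in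
lemma conj_unitary (hφ : IsRealTrace φ) {u : 𝒜} (hu : u ∈ unitary 𝒜) (x : 𝒜) : φ (u * x * star u) = φ x := by
  rw [hφ.comm, ← mul_assoc, Unitary.star_mul_self_of_mem hu, one_mul]

end IsRealTrace

lemma star_rpow (a : 𝒜) (s : ℝ) : star (a ^ s) = a ^ s :=
  (IsSelfAdjoint.of_nonneg CFC.rpow_nonneg).star_eq

lemma rpow_convexComb_le {a : 𝒜} (ha : IsStrictlyPositive a) (u v : ℝ) {t : ℝ}
    (ht₀ : 0 ≤ t) (ht₁ : t ≤ 1) :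
    a ^ ((1 - t) * u + t * v) ≤ a ^ u + a ^ v := by
  have h0 : 0 ∉ spectrum NNReal a := spectrum.zero_notMem _ ha.isUnit
  have hc (s : ℝ) : ContinuousOn (fun x : NNReal => x ^ s) (spectrum NNReal a) :=
    fun x hx => (NNReal.continuousAt_rpow_const
      (Or.inl (fun h => h0 (h ▸ hx)))).continuousWithinAt
  simp only [CFC.rpow_def]
  rw [← cfc_add a _ _ (hc u) (hc v)]
  refine cfc_mono (fun x hx => ?_) (hc _) ((hc u).add (hc v))
  have hx0 : (0 : ℝ) < x := by
    have : x ≠ 0 := fun h => h0 (h ▸ hx)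
    positivity
  rw [← NNReal.coe_le_coe]
  push_cast
  have h := Real.geom_mean_le_arith_mean2_weighted (sub_nonneg.mpr ht₁) ht₀
    (Real.rpow_nonneg hx0.le u) (Real.rpow_nonneg hx0.le v) (by ring)
  rw [← Real.rpow_mul hx0.le, ← Real.rpow_mul hx0.le, ← Real.rpow_add hx0] at h
  have h1 := Real.rpow_nonneg hx0.le u
  have h2 := Real.rpow_nonneg hx0.le v
  rw [show (1 - t) * u + t * v = u * (1 - t) + v * t by ring]
  nlinarith

/-- A bounded midpoint-convex function on the unit interval that vanishes at the endpoints is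
nonpositive. -/
lemma nonpos_of_midpoint_convex {h : ℝ → ℝ} {C : ℝ}
    (hmid : ∀ s ∈ Set.Icc (0 : ℝ) 1, ∀ t ∈ Set.Icc (0 : ℝ) 1, h ((s + t) / 2) ≤ (h s + h t) / 2)
    (hC : ∀ t ∈ Set.Icc (0 : ℝ) 1, h t ≤ C) (h₀ : h 0 = 0) (h₁ : h 1 = 0)
    {t : ℝ} (ht : t ∈ Set.Icc (0 : ℝ) 1) : h t ≤ 0 := by
  have key : ∀ n : ℕ, ∀ t ∈ Set.Icc (0 : ℝ) 1, h t ≤ (1 / 2) ^ n * C := by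
    intro n
    induction n with
    | zero => simpa using hC
    | succ n ih =>
      intro t ht
      rcases le_total t (1 / 2) with h2 | h2
      · have h3 : 2 * t ∈ Set.Icc (0 : ℝ) 1 := ⟨by linarith [ht.1], by linarith⟩
        have h4 := hmid 0 (by simp) (2 * t) h3
        rw [show (0 + 2 * t) / 2 = t by ring] at h4
        have := ih _ h3
        rw [pow_succ]
        linarith
      · have h3 : 2 * t - 1 ∈ Set.Icc (0 : ℝ) 1 := ⟨by linarith, by linarith [ht.2]⟩
        have h4 := hmid 1 (by simp) (2 * t - 1) h3
        rw [show (1 + (2 * t - 1)) / 2 = t by ring] at h4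
        have := ih _ h3
        rw [pow_succ]
        linarith
  refine ge_of_tendsto' (f := fun n : ℕ => (1 / 2 : ℝ) ^ n * C) (x := Filter.atTop) ?_
    (fun n => key n t ht)
  simpa using (tendsto_pow_atTop_nhds_zero_of_lt_one (r := (1 / 2 : ℝ)) (by norm_num)
    (by norm_num)).mul_const C

namespace IsRealTrace

variable {φ : 𝒜 →ₗ[ℝ] ℝ}

/-- Convexity of `t ↦ φ (a ^ u(t) * b ^ v(t))` along affine exponents `u` and `v`. -/
lemma rpow_mul_rpow_le (hφ : IsRealTrace φ) {a b : 𝒜} (ha : IsStrictlyPositive a)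
    (hb : IsStrictlyPositive b)
    (u₀ u₁ v₀ v₁ : ℝ) {t : ℝ} (ht₀ : 0 ≤ t) (ht₁ : t ≤ 1) :
    φ (a ^ ((1 - t) * u₀ + t * u₁) * b ^ ((1 - t) * v₀ + t * v₁)) ≤
      (1 - t) * φ (a ^ u₀ * b ^ v₀) + t * φ (a ^ u₁ * b ^ v₁) := by
  set g : ℝ → ℝ := fun t =>
    φ (a ^ ((1 - t) * u₀ + t * u₁) * b ^ ((1 - t) * v₀ + t * v₁)) -
      ((1 - t) * φ (a ^ u₀ * b ^ v₀) + t * φ (a ^ u₁ * b ^ v₁)) with hg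
  have haa (s : ℝ) : a ^ (s / 2) * a ^ (s / 2) = a ^ s := by
    rw [← CFC.rpow_add ha.isUnit, add_halves]
  have hbb (s : ℝ) : b ^ (s / 2) * b ^ (s / 2) = b ^ s := by
    rw [← CFC.rpow_add hb.isUnit, add_halves]
  have hmid (u u' v v' : ℝ) : φ (a ^ ((u + u') / 2) * b ^ ((v + v') / 2)) ≤
      (φ (a ^ u * b ^ v) + φ (a ^ u' * b ^ v')) / 2 := by
    have h := hφ.mul_le (b ^ (v / 2) * a ^ (u / 2)) (a ^ (u' / 2) * b ^ (v' / 2))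
    simp only [star_mul, star_rpow] at h
    have e1 : φ (b ^ (v / 2) * a ^ (u / 2) * (a ^ (u' / 2) * b ^ (v' / 2))) =
        φ (a ^ ((u + u') / 2) * b ^ ((v + v') / 2)) := by
      rw [mul_assoc, hφ.comm, add_div, add_div, CFC.rpow_add ha.isUnit, add_comm (v / 2),
        CFC.rpow_add hb.isUnit]
      simp only [mul_assoc]
    have e2 : φ (b ^ (v / 2) * a ^ (u / 2) * (a ^ (u / 2) * b ^ (v / 2))) = φ (a ^ u * b ^ v) := by
      rw [mul_assoc, hφ.comm, ← haa u, ← hbb v]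
      simp only [mul_assoc]
    have e3 : φ (b ^ (v' / 2) * a ^ (u' / 2) * (a ^ (u' / 2) * b ^ (v' / 2))) =
        φ (a ^ u' * b ^ v') := by
      rw [mul_assoc, hφ.comm, ← haa u', ← hbb v']
      simp only [mul_assoc]
    rwa [e1, e2, e3] at h
  have hgt : g t ≤ 0 := by
    refine nonpos_of_midpoint_convex (h := g)
      (C := (φ (a ^ (2 * u₀)) + φ (a ^ (2 * u₁)) + φ (b ^ (2 * v₀)) + φ (b ^ (2 * v₁))) / 2 +
        |φ (a ^ u₀ * b ^ v₀)| + |φ (a ^ u₁ * b ^ v₁)|) ?_ ?_ (by simp [hg]) (by simp [hg])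
      ⟨ht₀, ht₁⟩
    · intro s _ t _
      have := hmid ((1 - s) * u₀ + s * u₁) ((1 - t) * u₀ + t * u₁)
        ((1 - s) * v₀ + s * v₁) ((1 - t) * v₀ + t * v₁)
      simp only [hg]
      rw [show (1 - (s + t) / 2) * u₀ + (s + t) / 2 * u₁ =
          ((1 - s) * u₀ + s * u₁ + ((1 - t) * u₀ + t * u₁)) / 2 by ring,
        show (1 - (s + t) / 2) * v₀ + (s + t) / 2 * v₁ =
          ((1 - s) * v₀ + s * v₁ + ((1 - t) * v₀ + t * v₁)) / 2 by ring]
      linarith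
    · rintro t ⟨ht₀, ht₁⟩
      have h := hφ.mul_le (a ^ ((1 - t) * u₀ + t * u₁)) (b ^ ((1 - t) * v₀ + t * v₁))
      simp only [star_rpow, ← CFC.rpow_add ha.isUnit, ← CFC.rpow_add hb.isUnit] at h
      have h1 := hφ.mono (rpow_convexComb_le ha (2 * u₀) (2 * u₁) ht₀ ht₁)
      have h2 := hφ.mono (rpow_convexComb_le hb (2 * v₀) (2 * v₁) ht₀ ht₁)
      rw [map_add] at h1 h2
      rw [show (1 - t) * u₀ + t * u₁ + ((1 - t) * u₀ + t * u₁) =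
          (1 - t) * (2 * u₀) + t * (2 * u₁) by ring,
        show (1 - t) * v₀ + t * v₁ + ((1 - t) * v₀ + t * v₁) =
          (1 - t) * (2 * v₀) + t * (2 * v₁) by ring] at h
      have h3 := neg_abs_le (φ (a ^ u₀ * b ^ v₀))
      have h4 := neg_abs_le (φ (a ^ u₁ * b ^ v₁))
      have h5 := abs_nonneg (φ (a ^ u₀ * b ^ v₀))
      have h6 := abs_nonneg (φ (a ^ u₁ * b ^ v₁))
      simp only [hg]
      nlinarith
  simp only [hg] at hgt
  linarith

end IsRealTrace

/-- Polar decomposition of an invertible element, with its effect on powers. -/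
lemma exists_unitary_polar {x : 𝒜} (hx : IsUnit x) :
    ∃ u ∈ unitary 𝒜, star x * u = (star x * x) ^ (1 / 2 : ℝ) ∧
      ∀ s : ℝ, (x * star x) ^ s = u * (star x * x) ^ s * star u := by
  have hz : IsStrictlyPositive (star x * x) :=
    CStarAlgebra.isStrictlyPositive_iff_eq_star_mul_self.mpr ⟨x, hx, rfl⟩
  set z := star x * x with hzdef
  have hx1 : star x * (x * z ^ (-(1 / 2) : ℝ)) = z ^ (1 / 2 : ℝ) := by
    rw [← mul_assoc, ← hzdef]
    nth_rw 1 [← CFC.rpow_one z]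
    rw [← CFC.rpow_add hz.isUnit]
    norm_num
  have hu1 : star (x * z ^ (-(1 / 2) : ℝ)) * (x * z ^ (-(1 / 2) : ℝ)) = 1 := by
    rw [star_mul, star_rpow, mul_assoc, hx1, CFC.rpow_neg_mul_rpow _ hz]
  have huu : IsUnit (x * z ^ (-(1 / 2) : ℝ)) := hx.mul (hz.isUnit.cfcRpow _ hz.nonneg)
  have hu : x * z ^ (-(1 / 2) : ℝ) ∈ unitary 𝒜 := by
    rw [Unitary.mem_iff]
    refine ⟨hu1, ?_⟩
    obtain ⟨w, hw⟩ := huu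
    rw [← hw] at hu1 ⊢
    rw [Units.mul_eq_one_iff_eq_inv.mp hu1, Units.mul_inv]
  refine ⟨_, hu, hx1, fun s => ?_⟩
  set u := x * z ^ (-(1 / 2) : ℝ) with hudef
  have hzu : u * z * star u = x * star x := by
    rw [hudef, star_mul, star_rpow]
    have : z ^ (-(1 / 2) : ℝ) * z * z ^ (-(1 / 2) : ℝ) = 1 := by
      nth_rw 2 [← CFC.rpow_one z]
      rw [← CFC.rpow_add hz.isUnit, ← CFC.rpow_add hz.isUnit]
      norm_num [CFC.rpow_zero z hz.nonneg]
    calc _ = x * (z ^ (-(1 / 2) : ℝ) * z * z ^ (-(1 / 2) : ℝ)) * star x := by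
          simp only [mul_assoc]
      _ = _ := by rw [this, mul_one]
  have h0 : 0 ∉ spectrum NNReal z := spectrum.zero_notMem _ hz.isUnit
  have hc : ContinuousOn (fun x : NNReal => x ^ s) (spectrum NNReal z) :=
    fun x hx => (NNReal.continuousAt_rpow_const
      (Or.inl (fun h => h0 (h ▸ hx)))).continuousWithinAt
  have hcont : Continuous (Unitary.conjStarAlgAut ℂ 𝒜 ⟨u, hu⟩) := by
    have : ⇑(Unitary.conjStarAlgAut ℂ 𝒜 ⟨u, hu⟩) = fun y => u * y * star u := by
      ext y; simp
    rw [this]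
    fun_prop
  have h := StarAlgHomClass.map_cfc (R := NNReal) (S := ℂ) (Unitary.conjStarAlgAut ℂ 𝒜 ⟨u, hu⟩)
    (fun x : NNReal => x ^ s) z hc hcont hz.nonneg (by
      simpa using star_right_conjugate_nonneg hz.nonneg u)
  simp only [Unitary.conjStarAlgAut_apply] at h
  rw [CFC.rpow_def, CFC.rpow_def, h, hzu]

/-- The power sandwich `b ^ β * a ^ (2 * α) * b ^ β` of strictly positive elements. -/
lemma rpow_sandwich_eq {a : 𝒜} (ha : IsStrictlyPositive a) (b : 𝒜) (α β : ℝ) :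
    b ^ β * a ^ (2 * α) * b ^ β = star (a ^ α * b ^ β) * (a ^ α * b ^ β) := by
  rw [star_mul, star_rpow, star_rpow, two_mul, CFC.rpow_add ha.isUnit]
  simp only [mul_assoc]

lemma isStrictlyPositive_rpow_sandwich {a b : 𝒜} (ha : IsStrictlyPositive a)
    (hb : IsStrictlyPositive b) (α β : ℝ) :
    IsStrictlyPositive (b ^ β * a ^ (2 * α) * b ^ β) := by
  rw [rpow_sandwich_eq ha]
  exact CStarAlgebra.isStrictlyPositive_iff_eq_star_mul_self.mpr
    ⟨_, (ha.isUnit.cfcRpow _ ha.nonneg).mul (hb.isUnit.cfcRpow _ hb.nonneg), rfl⟩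

/-- The weighted Young form of the tracial Hölder inequality with exponents `1 / α` and `1 / β`. -/
def HolderYoung (φ : 𝒜 →ₗ[ℝ] ℝ) (α β : ℝ) : Prop :=
  ∀ a b : 𝒜, IsStrictlyPositive a → IsStrictlyPositive b →
    (α + β) * φ ((b ^ β * a ^ (2 * α) * b ^ β) ^ (1 / (2 * (α + β)) : ℝ)) ≤ α * φ a + β * φ b

namespace IsRealTrace

variable {φ : 𝒜 →ₗ[ℝ] ℝ}

lemma rpow_star_mul_self (hφ : IsRealTrace φ) {x : 𝒜} (hx : IsUnit x) (s : ℝ) :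
    φ ((x * star x) ^ s) = φ ((star x * x) ^ s) := by
  obtain ⟨u, hu, -, h⟩ := exists_unitary_polar hx
  rw [h s, hφ.conj_unitary hu]

lemma holderYoung_symm (hφ : IsRealTrace φ) {α β : ℝ} (h : HolderYoung φ α β) :
    HolderYoung φ β α := by
  intro a b ha hb
  have hu : IsUnit (b ^ α * a ^ β) :=
    (hb.isUnit.cfcRpow _ hb.nonneg).mul (ha.isUnit.cfcRpow _ ha.nonneg)
  have h1 := h b a hb ha
  rw [rpow_sandwich_eq hb, ← hφ.rpow_star_mul_self hu] at h1
  have e : b ^ α * a ^ β * star (b ^ α * a ^ β) = b ^ α * a ^ (2 * β) * b ^ α := by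
    rw [star_mul, star_rpow, star_rpow, two_mul, CFC.rpow_add ha.isUnit]
    simp only [mul_assoc]
  rw [e] at h1
  rw [add_comm β α]
  linarith

lemma holderYoung_of_le_half (hφ : IsRealTrace φ) {α β : ℝ} (hα : 0 < α) (hβ : 0 < β)
    (hα' : α ≤ 1 / 2) (hβ' : β ≤ 1 / 2) : HolderYoung φ α β := by
  intro a b ha hb
  have hx : IsUnit (a ^ α * b ^ β) :=
    (ha.isUnit.cfcRpow _ ha.nonneg).mul (hb.isUnit.cfcRpow _ hb.nonneg)
  have hz := isStrictlyPositive_rpow_sandwich ha hb α β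
  have hw : IsStrictlyPositive (a ^ α * b ^ β * star (a ^ α * b ^ β)) :=
    CStarAlgebra.isStrictlyPositive_iff_eq_mul_star_self.mpr ⟨_, hx, rfl⟩
  obtain ⟨u, hu, hsqrt, hconj⟩ := exists_unitary_polar hx
  rw [← rpow_sandwich_eq ha] at hsqrt hconj
  set z := b ^ β * a ^ (2 * α) * b ^ β
  set w := a ^ α * b ^ β * star (a ^ α * b ^ β)
  set q : ℝ := 1 / (2 * (α + β)) with hq
  have hq' : q * (α + β) = 1 / 2 := by rw [hq]; field_simp
  set l := q * (1 - 2 * α) / 2 with hl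
  set m := q * (1 - 2 * β) / 2 with hm
  have hlm : q = 1 / 2 + (l + m) := by
    rw [hl, hm]; linarith
  have ez : z ^ q = (b ^ β * a ^ α * u * z ^ l) * z ^ m := by
    rw [hlm, CFC.rpow_add hz.isUnit, ← hsqrt, CFC.rpow_add hz.isUnit, star_mul, star_rpow,
      star_rpow]
    simp only [mul_assoc]
  have h1 := hφ.mul_le (a ^ α * u * z ^ l) (z ^ m * b ^ β)
  have e0 : φ (a ^ α * u * z ^ l * (z ^ m * b ^ β)) = φ (z ^ q) := by
    rw [ez, ← mul_assoc, hφ.comm]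
    simp only [mul_assoc]
  have e1 : φ (a ^ α * u * z ^ l * star (a ^ α * u * z ^ l)) =
      φ (a ^ (2 * α) * w ^ (q * (1 - 2 * α))) := by
    rw [hconj, show q * (1 - 2 * α) = l + l by rw [hl]; ring, CFC.rpow_add hz.isUnit, two_mul α,
      CFC.rpow_add ha.isUnit]
    simp only [star_mul, star_rpow]
    rw [mul_assoc (a ^ α) (a ^ α), hφ.comm (a ^ α) (a ^ α * _)]
    simp only [mul_assoc]
  have e2 : φ (star (z ^ m * b ^ β) * (z ^ m * b ^ β)) =
      φ (b ^ (2 * β) * z ^ (q * (1 - 2 * β))) := by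
    rw [show q * (1 - 2 * β) = m + m by rw [hm]; ring, CFC.rpow_add hz.isUnit, two_mul β,
      CFC.rpow_add hb.isUnit]
    simp only [star_mul, star_rpow]
    rw [mul_assoc (b ^ β) (b ^ β), hφ.comm (b ^ β) (b ^ β * _)]
    simp only [mul_assoc]
  have ew : φ (w ^ q) = φ (z ^ q) := by rw [hconj, hφ.conj_unitary hu]
  have h2 := hφ.rpow_mul_rpow_le ha hw 0 1 q 0 (t := 2 * α) (by linarith) (by linarith)
  have h3 := hφ.rpow_mul_rpow_le hb hz 0 1 q 0 (t := 2 * β) (by linarith) (by linarith)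
  simp only [mul_zero, mul_one, zero_add, add_zero, CFC.rpow_zero _ ha.nonneg,
    CFC.rpow_zero _ hb.nonneg, CFC.rpow_zero _ hw.nonneg, CFC.rpow_zero _ hz.nonneg, one_mul,
    CFC.rpow_one _ ha.nonneg, CFC.rpow_one _ hb.nonneg] at h2 h3
  rw [mul_comm _ q] at h2 h3
  rw [e0, e1, e2] at h1
  rw [ew] at h2
  linarith

lemma holderYoung_add_half (hφ : IsRealTrace φ) {α β : ℝ} (hα : 0 < α) (hβ : 0 < β)
    (h : HolderYoung φ α β) : HolderYoung φ (α + 1 / 2) β := by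
  intro a b ha hb
  have hz := isStrictlyPositive_rpow_sandwich ha hb (α + 1 / 2) β
  have hv := isStrictlyPositive_rpow_sandwich ha hb α β
  have hab := h a b ha hb
  have hzv : b ^ β * a ^ (2 * (α + 1 / 2)) * b ^ β =
      b ^ β * a * b ^ (-β) * (b ^ β * a ^ (2 * α) * b ^ β) := by
    have e : a ^ (2 * (α + 1 / 2)) = a * a ^ (2 * α) := by
      nth_rw 2 [← CFC.rpow_one a]
      rw [← CFC.rpow_add ha.isUnit]
      congr 1; ring
    calc _ = b ^ β * (a * a ^ (2 * α)) * b ^ β := by rw [e]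
      _ = b ^ β * a * (b ^ (-β) * b ^ β) * a ^ (2 * α) * b ^ β := by
        rw [CFC.rpow_neg_mul_rpow β hb]; simp only [mul_assoc, one_mul]
      _ = _ := by simp only [mul_assoc]
  set z := b ^ β * a ^ (2 * (α + 1 / 2)) * b ^ β
  set v := b ^ β * a ^ (2 * α) * b ^ β
  have hzv' : φ (z * v ^ (-1 : ℝ)) = φ a := by
    have e : v * v ^ (-1 : ℝ) = 1 := by
      have := CFC.rpow_mul_rpow_neg (a := v) 1 hv
      rwa [CFC.rpow_one v hv.nonneg] at this
    rw [hzv, mul_assoc, e, mul_one, hφ.comm, ← mul_assoc, CFC.rpow_neg_mul_rpow β hb, one_mul]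
  have hs : 0 < α + β := by positivity
  set q : ℝ := 1 / (2 * (α + 1 / 2 + β)) with hq
  have hq' : q * (2 * (α + β) + 1) = 1 := by rw [hq]; field_simp; ring
  have hq0 : 0 < q := by rw [hq]; positivity
  have hq1 : q ≤ 1 := by nlinarith
  have h1 := hφ.rpow_mul_rpow_le hz hv 0 1 (1 / (2 * (α + β))) (-1) hq0.le hq1
  have e0 : (1 - q) * (1 / (2 * (α + β))) + q * (-1) = 0 := by
    field_simp; linarith
  simp only [e0, mul_zero, mul_one, zero_add, CFC.rpow_zero _ hz.nonneg,
    CFC.rpow_zero _ hv.nonneg, CFC.rpow_one _ hz.nonneg, one_mul, hzv'] at h1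
  set F := φ (v ^ (1 / (2 * (α + β))))
  have h2 : (α + 1 / 2 + β) * ((1 - q) * F + q * φ a) = (α + β) * F + 1 / 2 * φ a := by
    linear_combination (φ a / 2 - F / 2) * hq'
  have h3 := mul_le_mul_of_nonneg_left h1 (show 0 ≤ α + 1 / 2 + β by linarith)
  rw [h2] at h3
  linarith

lemma holderYoung_left (hφ : IsRealTrace φ) {β : ℝ} (hβ : 0 < β)
    (h : ∀ α, 0 < α → α ≤ 1 / 2 → HolderYoung φ α β) {α : ℝ} (hα : 0 < α) :
    HolderYoung φ α β := by
  have key : ∀ n : ℕ, ∀ α : ℝ, 0 < α → α ≤ (n + 1) / 2 → HolderYoung φ α β := by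
    intro n
    induction n with
    | zero => intro α h0 h1; exact h α h0 (by simpa using h1)
    | succ n ih =>
      intro α h0 h1
      rcases le_or_gt α (1 / 2) with h2 | h2
      · exact h α h0 h2
      · have := hφ.holderYoung_add_half (by linarith) hβ
          (ih (α - 1 / 2) (by linarith) (by push_cast at h1; linarith))
        rwa [sub_add_cancel] at this
  obtain ⟨n, hn⟩ := exists_nat_ge (2 * α)
  exact key n α hα (by linarith)

/-- The tracial Hölder inequality holds for all positive exponents. -/
theorem holderYoung (hφ : IsRealTrace φ) {α β : ℝ} (hα : 0 < α) (hβ : 0 < β) :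
    HolderYoung φ α β := by
  refine hφ.holderYoung_left hβ (fun α hα hα' => ?_) hα
  exact hφ.holderYoung_symm (hφ.holderYoung_left hα
    (fun β hβ hβ' => hφ.holderYoung_of_le_half hβ hα hβ' hα') hβ)

end IsRealTrace

lemma continuousOn_rpow_of_nonneg {s : ℝ} (hs : 0 ≤ s) :
    ContinuousOn (fun a : 𝒜 => a ^ s) {a | 0 ≤ a} :=
  continuousOn_id.cfc_nnreal_of_mem_nhdsSet (s := Set.univ) (fun x : NNReal => x ^ s)
    Filter.univ_mem (fun _ h => h) (NNReal.continuous_rpow_const hs).continuousOn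

lemma smul_rpow {a : 𝒜} (ha : 0 ≤ a) {s : ℝ} (hs : 0 ≤ s) (c : NNReal) :
    (c • a) ^ s = c ^ s • a ^ s := by
  have hc : Continuous fun x : NNReal => x ^ s := NNReal.continuous_rpow_const hs
  rw [CFC.rpow_def, CFC.rpow_def, ← cfc_comp_smul c _ a hc.continuousOn ha,
    ← cfc_smul (c ^ s) _ a hc.continuousOn]
  simp [NNReal.mul_rpow]

/-- Optimizing the weight in the arithmetic mean yields the geometric mean. -/
lemma le_sqrt_mul_of_forall_le {x a b : ℝ} (ha : 0 ≤ a) (hb : 0 ≤ b)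
    (h : ∀ c : ℝ, 0 < c → x ≤ (c * a + c⁻¹ * b) / 2) : x ≤ √(a * b) := by
  have key : ∀ ε : ℝ, 0 < ε → x ≤ √((a + ε) * (b + ε)) := by
    intro ε hε
    have hA : 0 < √(a + ε) := Real.sqrt_pos.mpr (by linarith)
    have hB : 0 < √(b + ε) := Real.sqrt_pos.mpr (by linarith)
    have hA2 : √(a + ε) ^ 2 = a + ε := Real.sq_sqrt (by linarith)
    have hB2 : √(b + ε) ^ 2 = b + ε := Real.sq_sqrt (by linarith)
    have hc := h (√(b + ε) / √(a + ε)) (by positivity)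
    rw [Real.sqrt_mul (by linarith)]
    have h1 : √(b + ε) / √(a + ε) * a ≤ √(a + ε) * √(b + ε) := by
      rw [div_mul_eq_mul_div, div_le_iff₀ hA]
      nlinarith
    have h2 : (√(b + ε) / √(a + ε))⁻¹ * b ≤ √(a + ε) * √(b + ε) := by
      rw [inv_div, div_mul_eq_mul_div, div_le_iff₀ hB]
      nlinarith
    linarith
  have hlim : Filter.Tendsto (fun ε : ℝ => √((a + ε) * (b + ε))) (nhdsWithin 0 (Set.Ioi 0))
      (nhds √(a * b)) := by
    have : Continuous fun ε : ℝ => √((a + ε) * (b + ε)) := by fun_prop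
    simpa using (this.tendsto 0).mono_left nhdsWithin_le_nhds
  exact ge_of_tendsto hlim (Filter.eventually_of_mem self_mem_nhdsWithin key)

namespace IsRealTrace

variable {φ : 𝒜 →ₗ[ℝ] ℝ}

lemma kappa_le_sqrt_of_isStrictlyPositive (hφ : IsRealTrace φ) {p : ℝ} (hp : 0 < p) {a b : 𝒜}
    (ha : IsStrictlyPositive a) (hb : IsStrictlyPositive b) :
    φ ((a ^ (p / 4) * b ^ (p / 2) * a ^ (p / 4)) ^ p⁻¹) ≤ √(φ a * φ b) := by
  refine le_sqrt_mul_of_forall_le (hφ.nonneg a ha.nonneg) (hφ.nonneg b hb.nonneg) fun c hc => ?_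
  have hpos {d : NNReal} (hd : d ≠ 0) {x : 𝒜} (hx : IsStrictlyPositive x) :
      IsStrictlyPositive (d • x) := by
    refine IsStrictlyPositive.iff_of_unital.mpr ⟨smul_nonneg d.2 hx.nonneg, ?_⟩
    have := hx.isUnit.smul (Units.mk0 d hd)
    exact this
  lift c to NNReal using hc.le
  have hc0 : c ≠ 0 := fun h => by simp [h] at hc
  have h := hφ.holderYoung (α := p / 4) (β := p / 4) (by positivity) (by positivity)
    (c⁻¹ • b) (c • a) (hpos (inv_ne_zero hc0) hb) (hpos hc0 ha)
  have e : (c • a) ^ (p / 4) * (c⁻¹ • b) ^ (p / 2) * (c • a) ^ (p / 4) =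
      a ^ (p / 4) * b ^ (p / 2) * a ^ (p / 4) := by
    rw [smul_rpow ha.nonneg (by positivity), smul_rpow hb.nonneg (by positivity)]
    simp only [smul_mul_assoc, mul_smul_comm, smul_smul]
    have : c ^ (p / 4) * c⁻¹ ^ (p / 2) * c ^ (p / 4) = 1 := by
      rw [mul_right_comm, ← NNReal.rpow_add hc0, ← add_div, show (p + p) / 4 = p / 2 by ring,
        ← NNReal.mul_rpow, mul_inv_cancel₀ hc0, NNReal.one_rpow]
    rw [← mul_assoc, this, one_smul]
  rw [show 2 * (p / 4) = p / 2 by ring, e, show 1 / (2 * (p / 4 + p / 4)) = p⁻¹ by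
    rw [inv_eq_one_div]; congr 1; ring, NNReal.smul_def, NNReal.smul_def, map_smul, map_smul] at h
  simp only [smul_eq_mul, NNReal.coe_inv] at h
  refine le_of_mul_le_mul_left (a := p / 2) ?_ (by positivity)
  linarith

/-- The tracial bound of the `κₚ`-mean by the geometric mean of the traces. -/
theorem kappa_le_sqrt (hφ : IsRealTrace φ) (hcont : Continuous φ) {p : ℝ} (hp : 0 < p) {a b : 𝒜}
    (ha : 0 ≤ a) (hb : 0 ≤ b) :
    φ ((a ^ (p / 4) * b ^ (p / 2) * a ^ (p / 4)) ^ p⁻¹) ≤ √(φ a * φ b) := by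
  have hshift (x : 𝒜) : Continuous fun ε : ℝ => x + algebraMap ℝ 𝒜 ε := by fun_prop
  have hnonneg {x : 𝒜} (hx : 0 ≤ x) : Set.MapsTo (fun ε : ℝ => x + algebraMap ℝ 𝒜 ε) (Set.Ici 0)
      {y | 0 ≤ y} := fun ε hε => add_nonneg hx (algebraMap_nonneg 𝒜 hε)
  have hpow {x : 𝒜} (hx : 0 ≤ x) {s : ℝ} (hs : 0 ≤ s) :
      ContinuousOn (fun ε : ℝ => (x + algebraMap ℝ 𝒜 ε) ^ s) (Set.Ici 0) :=
    (continuousOn_rpow_of_nonneg hs).comp (hshift x).continuousOn (hnonneg hx)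
  have hl : ContinuousOn (fun ε : ℝ => φ (((a + algebraMap ℝ 𝒜 ε) ^ (p / 4) *
      (b + algebraMap ℝ 𝒜 ε) ^ (p / 2) * (a + algebraMap ℝ 𝒜 ε) ^ (p / 4)) ^ p⁻¹))
      (Set.Ici 0) := by
    refine hcont.comp_continuousOn ((continuousOn_rpow_of_nonneg (inv_nonneg.mpr hp.le)).comp
      (((hpow ha (by positivity)).mul (hpow hb (by positivity))).mul (hpow ha (by positivity))) ?_)
    intro ε _
    have := star_left_conjugate_nonneg (CFC.rpow_nonneg (a := b + algebraMap ℝ 𝒜 ε) (y := p / 2))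
      ((a + algebraMap ℝ 𝒜 ε) ^ (p / 4))
    rwa [star_rpow] at this
  have hr : Continuous fun ε : ℝ => √(φ (a + algebraMap ℝ 𝒜 ε) * φ (b + algebraMap ℝ 𝒜 ε)) :=
    ((hcont.comp (hshift a)).mul (hcont.comp (hshift b))).sqrt
  have hl0 := (hl 0 Set.self_mem_Ici).mono Set.Ioi_subset_Ici_self
  have hr0 := hr.continuousWithinAt (s := Set.Ioi 0) (x := 0)
  have h := le_of_tendsto_of_tendsto hl0 hr0
    (Filter.eventually_of_mem self_mem_nhdsWithin fun ε (hε : 0 < ε) =>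
      hφ.kappa_le_sqrt_of_isStrictlyPositive hp
        (IsStrictlyPositive.nonneg_add ha (IsStrictlyPositive.iff_of_unital.mpr
          ⟨algebraMap_nonneg 𝒜 hε.le, (IsUnit.mk0 ε hε.ne').map (algebraMap ℝ 𝒜)⟩))
        (IsStrictlyPositive.nonneg_add hb (IsStrictlyPositive.iff_of_unital.mpr
          ⟨algebraMap_nonneg 𝒜 hε.le, (IsUnit.mk0 ε hε.ne').map (algebraMap ℝ 𝒜)⟩)))
  simpa using h

end IsRealTrace

end TracialFunctional

/-- Trace arithmetic–κₚ inequality in a unital C*-algebra with a faithful tracial positive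
linear functional: `τ(A κₚ B) ≤ √(τ(A)·τ(B)) ≤ τ((A + B)/2)` for all `p > 0` and positive
`A, B`, where `A κₚ B := (A^{p/4} B^{p/2} A^{p/4})^{1/p}` via the continuous functional
calculus on `[0, ∞)`. -/
theorem cstar_trace_kappa_le_sqrt_le_am {𝒜 : Type*} [CStarAlgebra 𝒜]
    [PartialOrder 𝒜] [StarOrderedRing 𝒜]
    (τ : 𝒜 →ₗ[ℂ] ℂ)
    (τ_pos : ∀ X : 𝒜, 0 ≤ X → 0 ≤ τ X)
    (τ_tracial : ∀ X Y : 𝒜, τ (X * Y) = τ (Y * X))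
    (τ_faithful : ∀ X : 𝒜, τ (star X * X) = 0 → X = 0)
    (p : ℝ) (hp : 0 < p) (A B : 𝒜) (hA : 0 ≤ A) (hB : 0 ≤ B) :
    τ ((A ^ (p / 4 : ℝ) * B ^ (p / 2 : ℝ) * A ^ (p / 4 : ℝ)) ^ (p⁻¹ : ℝ)) ≤
        (Real.sqrt ((τ A).re * (τ B).re) : ℂ) ∧
      (Real.sqrt ((τ A).re * (τ B).re) : ℂ) ≤ τ ((2 : ℂ)⁻¹ • (A + B)) := by
  have hφ := isRealTrace_re τ τ_pos τ_tracial
  have hcont : Continuous (Complex.reLm ∘ₗ τ.restrictScalars ℝ) :=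
    Complex.continuous_re.comp (map_continuous (PositiveLinearMap.mk₀ τ τ_pos))
  have hre (X : 𝒜) (hX : 0 ≤ X) : τ X = ((τ X).re : ℂ) :=
    Complex.ext rfl (by simpa using ((Complex.nonneg_iff.mp (τ_pos X hX)).2).symm)
  have hA0 := hφ.nonneg A hA
  have hB0 := hφ.nonneg B hB
  simp only [LinearMap.comp_apply, LinearMap.restrictScalars_apply, Complex.reLm_coe] at hA0 hB0
  constructor
  · rw [hre _ CFC.rpow_nonneg, Complex.real_le_real]
    exact hφ.kappa_le_sqrt hcont hp hA hB
  · rw [map_smul, map_add, hre A hA, hre B hB, Complex.ofReal_re, Complex.ofReal_re, smul_eq_mul,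
      show (2 : ℂ)⁻¹ * ((τ A).re + (τ B).re) = (((τ A).re + (τ B).re) / 2 : ℝ) by
        push_cast; ring, Complex.real_le_real]
    rw [Real.sqrt_le_left (by positivity)]
    nlinarith [sq_nonneg ((τ A).re - (τ B).re)]
end
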